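/- arXiv:1202.0677 — 4 statements merged into one kernel-verified Lean document; each statement's English description precedes it below -/
import Mathlib

section
/- The logistic birth and death process X fulfills Hypothesis (H). In particular, it has a unique quasi-stationary distribution ρ, and there exist positive constants C and γ such that for every probability measure μ on ℕ* and all t ≥ 0, ‖ℙ_μ(X_t ∈ · | t < T_0) − ρ‖_TV ≤ C e^{−γ t}. -/
open MeasureTheory ENNReal Set Filter
open scoped NNReal ENNReal

noncomputable section

/-- A right-continuous, time-homogeneous Markov process on `ℕ` with laws `P x`
(`P x (X 0 = x) = 1`), in which the state `0` is absorbing and absorption is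
almost sure. The (time-homogeneous, countable-state) Markov property is stated
in terms of the shifted path. -/
structure AbsorbedProcess (Ω : Type*) [MeasurableSpace Ω] where
  P : ℕ → Measure Ω
  prob : ∀ x, IsProbabilityMeasure (P x)
  X : ℝ≥0 → Ω → ℕ
  meas : ∀ t, Measurable (X t)
  init : ∀ x, P x {ω | X 0 ω = x} = 1
  rightCont : ∀ x, ∀ᵐ ω ∂ P x, ∀ t : ℝ≥0, ∃ ε : ℝ≥0, 0 < ε ∧
    ∀ s : ℝ≥0, t ≤ s → s < t + ε → X s ω = X t ω
  markov : ∀ (x y : ℕ) (s : ℝ≥0) (B : Set (ℝ≥0 → ℕ)), MeasurableSet B →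
    P x ({ω | X s ω = y} ∩ {ω | (fun u => X (s + u) ω) ∈ B})
      = P x {ω | X s ω = y} * P y {ω | (fun u => X u ω) ∈ B}
  absorbing : ∀ x, ∀ᵐ ω ∂ P x, ∀ s t : ℝ≥0, s ≤ t → X s ω = 0 → X t ω = 0
  absorbSure : ∀ x, P x {ω | ∃ t : ℝ≥0, X t ω = 0} = 1

variable {Ω : Type*} [MeasurableSpace Ω]

/-- The hitting time `T_K = inf {t ≥ 0 : X_t ∈ K}` (equal to `∞` if `K` is never hit). -/
def hitT (M : AbsorbedProcess Ω) (K : Set ℕ) (ω : Ω) : ℝ≥0∞ :=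
  ⨅ t : {t : ℝ≥0 // M.X t ω ∈ K}, (t.1 : ℝ≥0∞)

/-- The survival event `{t < T_0}`. -/
def alive (M : AbsorbedProcess Ω) (t : ℝ≥0) : Set Ω := {ω | (t : ℝ≥0∞) < hitT M {0} ω}

/-- `ℙ_μ = ∑_x μ({x}) ℙ_x`. -/
def Pmu (M : AbsorbedProcess Ω) (μ : Measure ℕ) : Measure Ω := μ.bind M.P

/-- The conditional distribution `ℙ_μ(X_t ∈ · | t < T_0)`, as a measure on `ℕ`. -/
def condDist (M : AbsorbedProcess Ω) (μ : Measure ℕ) (t : ℝ≥0) : Measure ℕ :=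
  (Pmu M μ (alive M t))⁻¹ • ((Pmu M μ).restrict (alive M t)).map (M.X t)

/-- Total variation distance between two measures on `ℕ`:
`‖μ - ν‖_TV = ∑_x |μ({x}) - ν({x})|`. -/
def tvDist (μ ν : Measure ℕ) : ℝ := ∑' x : ℕ, |(μ {x}).toReal - (ν {x}).toReal|

/-- `e^{l·t}` for an extended nonnegative time `t`. -/
def expE (l : ℝ) (t : ℝ≥0∞) : ℝ≥0∞ :=
  if t = ∞ then ∞ else ENNReal.ofReal (Real.exp (l * t.toReal))

/-- Hypothesis (H): there are `K ⊆ ℕ*`, `x₀ ∈ K` and positive constants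
`c₁, c₂, c₃, c₄, λ₀` such that
(1) `ℙ_x(X_1 = x₀ | 1 < T_0) ≥ c₁` for all `x ∈ ℕ*`;
(2) `inf_{x ∈ K} ℙ_x(t < T_0) ≥ c₂ sup_{x ∈ K} ℙ_x(t < T_0)` for all `t ≥ 0`;
(3) `ℙ_{x₀}(X_t ∈ K) ≥ c₃ e^{-λ₀ t}` for all `t ≥ 0`;
(4) `sup_{x ∈ ℕ*} 𝔼_x(e^{λ₀ (T_K ∧ T_0)}) ≤ c₄`. -/
def HypH (M : AbsorbedProcess Ω) (K : Set ℕ) (x0 : ℕ) (c1 c2 c3 c4 l0 : ℝ) : Prop :=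
  0 ∉ K ∧ x0 ∈ K ∧ 0 < c1 ∧ 0 < c2 ∧ 0 < c3 ∧ 0 < c4 ∧ 0 < l0 ∧
  (∀ x : ℕ, x ≠ 0 → ENNReal.ofReal c1 * M.P x (alive M 1)
      ≤ M.P x ({ω | M.X 1 ω = x0} ∩ alive M 1)) ∧
  (∀ t : ℝ≥0, ∀ x ∈ K, ∀ y ∈ K,
      ENNReal.ofReal c2 * M.P y (alive M t) ≤ M.P x (alive M t)) ∧
  (∀ t : ℝ≥0, ENNReal.ofReal (c3 * Real.exp (-(l0 * (t : ℝ)))) ≤ M.P x0 {ω | M.X t ω ∈ K}) ∧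
  (∀ x : ℕ, x ≠ 0 →
      ∫⁻ ω, expE l0 (min (hitT M K ω) (hitT M {0} ω)) ∂ M.P x ≤ ENNReal.ofReal c4)

/-- The transition function `P_t(x,y) = ℙ_x(X_t = y)`, extended by `t ↦ max t 0`
to negative times. -/
def transFn (M : AbsorbedProcess Ω) (t : ℝ) (x y : ℕ) : ℝ :=
  (M.P x {ω | M.X t.toNNReal ω = y}).toReal

/-- `Q` is the (stable, conservative) transition rate matrix of the chain `M`,
`0` is absorbing for `Q`, and `M` is an honest (non-explosive) chain with
q-matrix `Q`: the transition function has right derivative `Q(x,y)` at `t = 0`. -/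
def IsRateMatrixOf (M : AbsorbedProcess Ω) (Q : ℕ → ℕ → ℝ) : Prop :=
  (∀ x y : ℕ, x ≠ y → 0 ≤ Q x y) ∧
  (∀ x : ℕ, Summable fun y : ℕ => if y = x then 0 else Q x y) ∧
  (∀ x : ℕ, Q x x = -∑' y : ℕ, if y = x then 0 else Q x y) ∧
  (∀ y : ℕ, Q 0 y = 0) ∧
  (∀ x y : ℕ, HasDerivWithinAt (fun t : ℝ => transFn M t x y) (Q x y) (Set.Ici (0 : ℝ)) 0)

/-- The transition rate matrix of the logistic birth and death process with
individual birth rate `b`, death rate `d` and competition rate `c`: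
`Q(x, x+1) = b x`, `Q(x, x-1) = d x + c x (x-1)` for `x ≥ 1`, all other
off-diagonal entries vanish, and `0` is absorbing. -/
def Qlog (b d c : ℝ) (x y : ℕ) : ℝ :=
  if x = 0 then 0
  else if y = x + 1 then b * x
  else if y + 1 = x then d * x + c * x * ((x : ℝ) - 1)
  else if y = x then -(b * x + d * x + c * x * ((x : ℝ) - 1))
  else 0

/-- Countable additivity of a finite measure in terms of real-valued sums. -/
lemma hasSum_real_iUnion {α : Type*} [MeasurableSpace α] (μ : Measure α) [IsFiniteMeasure μ]
    {f : ℕ → Set α} (hf : ∀ n, MeasurableSet (f n)) (hd : Pairwise (Function.onFun Disjoint f)) :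
    HasSum (fun n => μ.real (f n)) (μ.real (⋃ n, f n)) := by
  have h := measure_iUnion hd hf (μ := μ)
  have hne : ∑' n, μ (f n) ≠ ∞ := h ▸ measure_ne_top μ _
  rw [measureReal_def, h, ENNReal.tsum_toReal_eq (ENNReal.ne_top_of_tsum_ne_top hne)]
  exact ENNReal.hasSum_toReal hne

/-! ### Occupation probabilities -/

/-- `ℙ_x(X_t ∈ E)` as a real number, with negative times sent to `0`. -/
def occ (M : AbsorbedProcess Ω) (E : Set ℕ) (t : ℝ) (x : ℕ) : ℝ :=
  (M.P x).real (M.X t.toNNReal ⁻¹' E)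

section Occupation

variable (M : AbsorbedProcess Ω)

lemma occ_nonneg (E : Set ℕ) (t : ℝ) (x : ℕ) : 0 ≤ occ M E t x := measureReal_nonneg

lemma occ_le_one (E : Set ℕ) (t : ℝ) (x : ℕ) : occ M E t x ≤ 1 := by
  have := M.prob x
  exact measureReal_le_one

lemma ofReal_occ (E : Set ℕ) (t : ℝ) (x : ℕ) :
    ENNReal.ofReal (occ M E t x) = M.P x (M.X t.toNNReal ⁻¹' E) := by
  have := M.prob x
  exact ofReal_measureReal

lemma measurableSet_occ (E : Set ℕ) (t : ℝ≥0) : MeasurableSet (M.X t ⁻¹' E) :=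
  M.meas t (MeasurableSet.of_discrete)

lemma occ_mono {E F : Set ℕ} (h : E ⊆ F) (t : ℝ) (x : ℕ) : occ M E t x ≤ occ M F t x := by
  have := M.prob x
  exact measureReal_mono (preimage_mono h)

lemma occ_univ (t : ℝ) (x : ℕ) : occ M univ t x = 1 := by
  have := M.prob x
  simp [occ]

lemma occ_compl (E : Set ℕ) (t : ℝ) (x : ℕ) : occ M Eᶜ t x = 1 - occ M E t x := by
  have := M.prob x
  exact probReal_compl_eq_one_sub (measurableSet_occ M E _)

lemma occ_union {E F : Set ℕ} (h : Disjoint E F) (t : ℝ) (x : ℕ) :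
    occ M (E ∪ F) t x = occ M E t x + occ M F t x := by
  have := M.prob x
  exact measureReal_union (h.preimage _) (measurableSet_occ M F _)

lemma occ_coe_finset (s : Finset ℕ) (t : ℝ) (x : ℕ) :
    occ M (s : Set ℕ) t x = ∑ y ∈ s, occ M {y} t x := by
  have := M.prob x
  induction s using Finset.induction_on with
  | empty => simp [occ]
  | insert a s ha ih =>
    rw [Finset.sum_insert ha, Finset.coe_insert, insert_eq, occ_union, ih]
    simpa using ha

lemma hasSum_occ_add (E : Set ℕ) {s t : ℝ} (hs : 0 ≤ s) (ht : 0 ≤ t) (x : ℕ) :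
    HasSum (fun y => occ M {y} s x * occ M E t y) (occ M E (s + t) x) := by
  have := M.prob x
  have hB : MeasurableSet {f : ℝ≥0 → ℕ | f t.toNNReal ∈ E} :=
    measurable_pi_apply t.toNNReal (MeasurableSet.of_discrete (s := E))
  have hd : Pairwise (Function.onFun Disjoint fun y =>
      {ω | M.X s.toNNReal ω = y} ∩ {ω | M.X (s.toNNReal + t.toNNReal) ω ∈ E}) := by
    intro y z hyz
    refine Set.disjoint_left.2 fun ω h1 h2 => hyz ?_
    exact h1.1.symm.trans h2.1
  have hU : M.X (s + t).toNNReal ⁻¹' E = ⋃ y, ({ω | M.X s.toNNReal ω = y} ∩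
      {ω | M.X (s.toNNReal + t.toNNReal) ω ∈ E}) := by
    ext ω
    simp [Real.toNNReal_add hs ht]
  have h := hasSum_real_iUnion (M.P x) (fun y => (measurableSet_occ M {y} _).inter
    (measurableSet_occ M E (s.toNNReal + t.toNNReal))) hd
  rw [occ, hU]
  have h2 : (fun y => occ M {y} s x * occ M E t y) = fun y => (M.P x).real
      (M.X s.toNNReal ⁻¹' {y} ∩ M.X (s.toNNReal + t.toNNReal) ⁻¹' E) := by
    funext y
    have h3 := congrArg ENNReal.toReal (M.markov x y s.toNNReal _ hB)
    rw [ENNReal.toReal_mul] at h3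
    exact h3.symm
  rw [h2]
  exact h

lemma hasSum_occ (t : ℝ) (x : ℕ) : HasSum (fun y => occ M {y} t x) 1 := by
  have := M.prob x
  have hd : Pairwise (Function.onFun Disjoint fun y => M.X t.toNNReal ⁻¹' {y}) := by
    intro y z hyz
    refine Set.disjoint_left.2 fun ω h1 h2 => hyz ?_
    exact h1.symm.trans h2
  have h := hasSum_real_iUnion (M.P x) (fun y => measurableSet_occ M {y} _) hd
  rwa [← preimage_iUnion, iUnion_of_singleton, preimage_univ, probReal_univ] at h

lemma ae_init (x : ℕ) : ∀ᵐ ω ∂ M.P x, M.X 0 ω = x := by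
  have := M.prob x
  exact (mem_ae_iff_prob_eq_one (measurableSet_occ M {x} 0)).2 (M.init x)

lemma occ_zero (E : Set ℕ) (x : ℕ) : occ M E 0 x = E.indicator 1 x := by
  have := M.prob x
  by_cases hx : x ∈ E
  · have h : M.X 0 ⁻¹' E =ᵐ[M.P x] (univ : Set Ω) := by
      refine eventuallyEq_set.2 ?_
      filter_upwards [ae_init M x] with ω hω
      simp [hω, hx]
    rw [indicator_of_mem hx, occ, Real.toNNReal_zero, measureReal_congr h, probReal_univ,
      Pi.one_apply]
  · have h : M.X 0 ⁻¹' E =ᵐ[M.P x] (∅ : Set Ω) := by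
      refine eventuallyEq_set.2 ?_
      filter_upwards [ae_init M x] with ω hω
      simp [hω, hx]
    rw [indicator_of_notMem hx, occ, Real.toNNReal_zero, measureReal_congr h, measureReal_empty]

lemma occ_at_zero (E : Set ℕ) {t : ℝ} : occ M E t 0 = E.indicator 1 0 := by
  have := M.prob 0
  rw [← occ_zero M]
  refine measureReal_congr (μ := M.P 0) (eventuallyEq_set.2 ?_)
  filter_upwards [ae_init M 0, M.absorbing 0] with ω h0 hω
  rw [mem_preimage, mem_preimage, hω 0 t.toNNReal zero_le h0, Real.toNNReal_zero, h0]

lemma occ_mul_le (E : Set ℕ) {s t : ℝ} (hs : 0 ≤ s) (ht : 0 ≤ t) (x y : ℕ) :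
    occ M {y} s x * occ M E t y ≤ occ M E (s + t) x :=
  le_hasSum (hasSum_occ_add M E hs ht x) y fun _ _ =>
    mul_nonneg (occ_nonneg ..) (occ_nonneg ..)

lemma occ_survival_antitone {s t : ℝ} (hs : 0 ≤ s) (hst : s ≤ t) (x : ℕ) :
    occ M {0}ᶜ t x ≤ occ M {0}ᶜ s x := by
  have h := occ_mul_le M {0} hs (sub_nonneg.2 hst) x 0
  rw [occ_at_zero] at h
  simp only [mem_singleton_iff, indicator_of_mem, Pi.one_apply, mul_one, add_sub_cancel] at h
  rw [occ_compl, occ_compl]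
  linarith

lemma alive_ae_eq (t : ℝ≥0) (x : ℕ) : alive M t =ᵐ[M.P x] M.X t ⁻¹' {0}ᶜ := by
  filter_upwards [M.rightCont x, M.absorbing x] with ω h1 h2
  refine propext ?_
  change (t : ℝ≥0∞) < hitT M {0} ω ↔ M.X t ω ≠ 0
  constructor
  · intro h h0
    exact absurd (iInf_le _ (⟨t, h0⟩ : {t : ℝ≥0 // M.X t ω ∈ ({0} : Set ℕ)})) (not_le.2 h)
  · intro h
    obtain ⟨ε, hε, h3⟩ := h1 t
    refine lt_of_lt_of_le (b := ((t + ε : ℝ≥0) : ℝ≥0∞)) ?_ (le_iInf ?_)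
    · exact_mod_cast lt_add_of_pos_right t hε
    · rintro ⟨s, hs⟩
      norm_cast
      by_contra! hlt
      rcases le_total t s with hts | hst
      · exact h ((h3 s hts hlt).symm.trans hs)
      · exact h (h2 s t hst hs)

lemma P_alive (t : ℝ≥0) (x : ℕ) : M.P x (alive M t) = ENNReal.ofReal (occ M {0}ᶜ t x) := by
  rw [ofReal_occ, Real.toNNReal_coe, measure_congr (alive_ae_eq M t x)]

end Occupation

/-! ### The backward equation -/

/-- A continuous function with a continuous right derivative on `[0, ∞)` is differentiable on
`(0, ∞)`. -/
lemma hasDerivAt_of_right {f f' : ℝ → ℝ} (hf : Continuous f) (hf' : Continuous f')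
    (h : ∀ t, 0 ≤ t → HasDerivWithinAt f (f' t) (Ici t) t) {t : ℝ} (ht : 0 < t) :
    HasDerivAt f (f' t) t := by
  have hI : ∀ s, HasDerivAt (fun s => ∫ u in (0 : ℝ)..s, f' u) (f' s) s := fun s =>
    intervalIntegral.integral_hasDerivAt_right (hf'.intervalIntegrable _ _)
      (hf'.stronglyMeasurableAtFilter _ _) hf'.continuousAt
  have hI' : Continuous (fun s => ∫ u in (0 : ℝ)..s, f' u) :=
    continuous_iff_continuousAt.2 fun s => (hI s).continuousAt
  have hc : ∀ s ∈ Icc 0 (t + 1), f s - (∫ u in (0 : ℝ)..s, f' u)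
      = f 0 - ∫ u in (0 : ℝ)..0, f' u := by
    refine constant_of_has_deriv_right_zero (f := fun s => f s - ∫ u in (0 : ℝ)..s, f' u)
      (hf.sub hI').continuousOn fun s hs => ?_
    exact ((h s hs.1).sub (hI s).hasDerivWithinAt).congr_deriv (sub_self _)
  refine ((hI t).add_const (f 0)).congr_of_eventuallyEq ?_
  filter_upwards [Ioo_mem_nhds ht (lt_add_one t)] with s hs
  have := hc s ⟨hs.1.le, hs.2.le⟩
  simp only [intervalIntegral.integral_same, sub_zero] at this
  linarith

/-- The generator of the logistic birth and death process. -/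
def logisticGen (b d c : ℝ) (f : ℕ → ℝ) (x : ℕ) : ℝ :=
  b * x * (f (x + 1) - f x) + (d * x + c * x * ((x : ℝ) - 1)) * (f (x - 1) - f x)

section Backward

variable (M : AbsorbedProcess Ω)

lemma hasSum_occ_sub (E : Set ℕ) {h t : ℝ} (hh : 0 ≤ h) (ht : 0 ≤ t) (x : ℕ) :
    HasSum (fun z => occ M {z} h x * (occ M E t z - occ M E t x))
      (occ M E (t + h) x - occ M E t x) := by
  have h1 := (hasSum_occ_add M E hh ht x).sub ((hasSum_occ M h x).mul_right (occ M E t x))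
  rw [one_mul, add_comm h t] at h1
  simpa only [mul_sub] using h1

lemma abs_occ_sub_occ_le_one (E : Set ℕ) (t : ℝ) (x y : ℕ) :
    |occ M E t x - occ M E t y| ≤ 1 := by
  rw [abs_le]
  constructor <;> linarith [occ_nonneg M E t x, occ_nonneg M E t y, occ_le_one M E t x,
    occ_le_one M E t y]

lemma abs_le_of_hasSum {f g : ℕ → ℝ} {a r : ℝ} (hf : HasSum f a) (hg : HasSum g r)
    (h : ∀ n, |f n| ≤ g n) : |a| ≤ r :=
  abs_le.2 ⟨hasSum_le (fun n => (abs_le.1 (h n)).1) hg.neg hf,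
    hasSum_le (fun n => (abs_le.1 (h n)).2) hf hg⟩

lemma abs_occ_add_sub_le (E : Set ℕ) {h t : ℝ} (hh : 0 ≤ h) (ht : 0 ≤ t) (x : ℕ) :
    |occ M E (t + h) x - occ M E t x| ≤ 1 - occ M {x} h x := by
  refine abs_le_of_hasSum (hasSum_occ_sub M E hh ht x)
    ((hasSum_occ M h x).sub (hasSum_ite_eq x (occ M {x} h x))) fun z => ?_
  rw [abs_mul, abs_of_nonneg (occ_nonneg ..)]
  split_ifs with hz
  · simp [hz]
  · rw [sub_zero]
    exact mul_le_of_le_one_right (occ_nonneg ..) (abs_occ_sub_occ_le_one ..)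

lemma abs_occ_add_sub_sub_le (E : Set ℕ) {h t : ℝ} (hh : 0 ≤ h) (ht : 0 ≤ t) {x : ℕ}
    (hx : x ≠ 0) :
    |occ M E (t + h) x - occ M E t x
        - occ M {x + 1} h x * (occ M E t (x + 1) - occ M E t x)
        - occ M {x - 1} h x * (occ M E t (x - 1) - occ M E t x)|
      ≤ 1 - occ M {x} h x - occ M {x + 1} h x - occ M {x - 1} h x := by
  refine abs_le_of_hasSum
    (((hasSum_occ_sub M E hh ht x).sub (hasSum_ite_eq (x + 1) _)).sub (hasSum_ite_eq (x - 1) _))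
    ((((hasSum_occ M h x).sub (hasSum_ite_eq x _)).sub (hasSum_ite_eq (x + 1) _)).sub
      (hasSum_ite_eq (x - 1) _)) fun z => ?_
  by_cases h1 : z = x
  · have h2 : x ≠ x + 1 := by omega
    have h3 : x ≠ x - 1 := by omega
    simp [h1, h3]
  by_cases h2 : z = x + 1
  · have h3 : x + 1 ≠ x - 1 := by omega
    simp [h2, h3]
  by_cases h3 : z = x - 1
  · have h4 : x - 1 ≠ x := by omega
    have h5 : x - 1 ≠ x + 1 := by omega
    simp [h3, h4, h5]
  simp only [h1, h2, h3, if_false, sub_zero]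
  rw [abs_mul, abs_of_nonneg (occ_nonneg ..)]
  exact mul_le_of_le_one_right (occ_nonneg ..) (abs_occ_sub_occ_le_one ..)

lemma abs_occ_sub_le (E : Set ℕ) {s t : ℝ} (hs : 0 ≤ s) (ht : 0 ≤ t) (x : ℕ) :
    |occ M E s x - occ M E t x| ≤ 1 - occ M {x} |s - t| x := by
  rcases le_total t s with h | h
  · simpa [abs_of_nonneg (sub_nonneg.2 h)] using abs_occ_add_sub_le M E (sub_nonneg.2 h) ht x
  · rw [abs_sub_comm, abs_sub_comm s t]
    simpa [abs_of_nonneg (sub_nonneg.2 h)] using abs_occ_add_sub_le M E (sub_nonneg.2 h) hs x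

variable {M} {b d c : ℝ} (hQ : IsRateMatrixOf M (Qlog b d c))
include hQ

lemma hasDerivWithinAt_occ_zero (x y : ℕ) :
    HasDerivWithinAt (fun t => occ M {y} t x) (Qlog b d c x y) (Ici 0) 0 := hQ.2.2.2.2 x y

lemma continuous_occ (E : Set ℕ) (x : ℕ) : Continuous fun t => occ M E t x := by
  have h0 : ContinuousOn (fun t => occ M E t x) (Ici 0) := by
    intro t ht
    have h1 : Tendsto (fun s : ℝ => |s - t|) (nhdsWithin t (Ici 0)) (nhdsWithin 0 (Ici 0)) := by
      refine tendsto_nhdsWithin_iff.2 ⟨?_, Eventually.of_forall fun s => mem_Ici.2 (abs_nonneg _)⟩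
      have : ContinuousAt (fun s : ℝ => |s - t|) t := by fun_prop
      have h2 := this.tendsto
      simp only [sub_self, abs_zero] at h2
      exact h2.mono_left nhdsWithin_le_nhds
    have h2 := ((hasDerivWithinAt_occ_zero hQ x x).continuousWithinAt.tendsto.comp h1).const_sub 1
    rw [occ_zero] at h2
    simp only [mem_singleton_iff, indicator_of_mem, Pi.one_apply, sub_self] at h2
    refine tendsto_iff_dist_tendsto_zero.2 (squeeze_zero' (Eventually.of_forall fun _ =>
      dist_nonneg) ?_ h2)
    filter_upwards [self_mem_nhdsWithin] with s hs
    exact abs_occ_sub_le M E hs ht x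
  have h1 : (fun t => occ M E t x) = (fun t => occ M E t x) ∘ fun t => max t 0 := by
    funext t
    simp [occ, Real.toNNReal]
  rw [h1]
  exact h0.comp_continuous (by fun_prop) fun t => mem_Ici.2 (le_max_right _ _)

lemma hasDerivWithinAt_occ (E : Set ℕ) {t : ℝ} (ht : 0 ≤ t) (x : ℕ) :
    HasDerivWithinAt (fun s => occ M E s x) (logisticGen b d c (occ M E t) x) (Ici t) t := by
  by_cases hx : x = 0
  · subst hx
    simpa [logisticGen, occ_at_zero] using hasDerivWithinAt_const t (Ici t) (E.indicator (1 : ℕ → ℝ) 0)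
  have e1 : Qlog b d c x (x + 1) = b * x := by simp [Qlog, hx]
  have e2 : Qlog b d c x (x - 1) = d * x + c * x * ((x : ℝ) - 1) := by
    have h3 : x - 1 ≠ x + 1 := by omega
    have h4 : x - 1 + 1 = x := by omega
    simp [Qlog, hx, h3, h4]
  have e3 : Qlog b d c x x = -(b * x + d * x + c * x * ((x : ℝ) - 1)) := by simp [Qlog, hx]
  have d1 := hasDerivWithinAt_occ_zero hQ x (x + 1)
  have d2 := hasDerivWithinAt_occ_zero hQ x (x - 1)
  have d3 := hasDerivWithinAt_occ_zero hQ x x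
  rw [e1] at d1
  rw [e2] at d2
  rw [e3] at d3
  have hr := ((d3.const_sub 1).sub d1).sub d2
  have z1 : occ M {x + 1} 0 x = 0 := by simp [occ_zero]
  have z2 : occ M {x - 1} 0 x = 0 := by
    have : x ≠ x - 1 := by omega
    simp [occ_zero, this]
  have z3 : occ M {x} 0 x = 1 := by simp [occ_zero]
  have hg : HasDerivWithinAt (fun h => occ M E (t + h) x - occ M E t x
        - occ M {x + 1} h x * (occ M E t (x + 1) - occ M E t x)
        - occ M {x - 1} h x * (occ M E t (x - 1) - occ M E t x)) 0 (Ici 0) 0 := by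
    rw [hasDerivWithinAt_iff_isLittleO] at hr ⊢
    simp only [Pi.sub_apply, z1, z2, z3, sub_zero, smul_zero, add_zero, zero_mul, sub_self] at hr ⊢
    refine Asymptotics.IsBigO.trans_isLittleO (Asymptotics.IsBigO.of_bound 1 ?_) hr
    filter_upwards [self_mem_nhdsWithin] with h hh
    rw [one_mul, Real.norm_eq_abs]
    refine (abs_occ_add_sub_sub_le M E hh ht hx).trans (le_trans (le_of_eq ?_) (le_abs_self _))
    rw [smul_eq_mul]
    ring
  have hmain := (hg.add ((d1.mul_const (occ M E t (x + 1) - occ M E t x)).add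
    (d2.mul_const (occ M E t (x - 1) - occ M E t x)))).add_const (occ M E t x)
  have hshift : HasDerivWithinAt (fun s : ℝ => s - t) 1 (Ici t) t :=
    (hasDerivWithinAt_id t (Ici t)).sub_const t
  have h := hmain.scomp_of_eq t hshift (fun s hs => mem_Ici.2 (sub_nonneg.2 (mem_Ici.1 hs)))
    (sub_self t).symm
  refine (h.congr_deriv ?_).congr_of_eventuallyEq ?_ ?_
  · simp [logisticGen]
  · filter_upwards with s
    simp only [Function.comp, Pi.add_apply]
    rw [add_sub_cancel]
    ring
  · simp only [Function.comp, Pi.add_apply]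
    rw [add_sub_cancel]
    ring

lemma continuous_logisticGen_occ (E : Set ℕ) (x : ℕ) :
    Continuous fun t => logisticGen b d c (occ M E t) x := by
  unfold logisticGen
  exact (continuous_const.mul ((continuous_occ hQ E _).sub (continuous_occ hQ E _))).add
    (continuous_const.mul ((continuous_occ hQ E _).sub (continuous_occ hQ E _)))

/-- Kolmogorov's backward equation. -/
lemma hasDerivAt_occ (E : Set ℕ) {t : ℝ} (ht : 0 < t) (x : ℕ) :
    HasDerivAt (fun s => occ M E s x) (logisticGen b d c (occ M E t) x) t :=
  hasDerivAt_of_right (continuous_occ hQ E x) (continuous_logisticGen_occ hQ E x)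
    (fun _ hs => hasDerivWithinAt_occ hQ E hs x) ht

end Backward

/-! ### A minimum principle for the backward equation -/

section MinimumPrinciple

variable {b d c : ℝ}

lemma logisticGen_add (f g : ℕ → ℝ) (x : ℕ) :
    logisticGen b d c (fun y => f y + g y) x = logisticGen b d c f x + logisticGen b d c g x := by
  unfold logisticGen
  ring

lemma logisticGen_sub (f g : ℕ → ℝ) (x : ℕ) :
    logisticGen b d c (fun y => f y - g y) x = logisticGen b d c f x - logisticGen b d c g x := by
  unfold logisticGen
  ring

lemma logisticGen_const_mul (a : ℝ) (f : ℕ → ℝ) (x : ℕ) :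
    logisticGen b d c (fun y => a * f y) x = a * logisticGen b d c f x := by
  unfold logisticGen
  ring

lemma deathRate_nonneg (hd : 0 < d) (hc : 0 < c) (x : ℕ) :
    0 ≤ d * x + c * x * ((x : ℝ) - 1) := by
  rcases Nat.eq_zero_or_pos x with rfl | hx
  · simp
  · have : (1 : ℝ) ≤ x := by exact_mod_cast hx
    have : 0 ≤ (x : ℝ) - 1 := by linarith
    positivity

lemma logisticGen_nonneg_of_eq_zero (hb : 0 < b) (hd : 0 < d) (hc : 0 < c) {f : ℕ → ℝ}
    (hf : ∀ y, 0 ≤ f y) {x : ℕ} (hx : f x = 0) : 0 ≤ logisticGen b d c f x := by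
  rw [logisticGen, hx, sub_zero, sub_zero]
  exact add_nonneg (mul_nonneg (by positivity) (hf _))
    (mul_nonneg (deathRate_nonneg hd hc x) (hf _))

lemma logisticGen_one_add_le (hd : 0 < d) (hc : 0 < c) (x : ℕ) :
    logisticGen b d c (fun y => 1 + (y : ℝ)) x ≤ b * x := by
  have h1 : ((x - 1 : ℕ) : ℝ) ≤ x := by exact_mod_cast Nat.sub_le x 1
  have h2 := mul_nonpos_of_nonneg_of_nonpos (deathRate_nonneg hd hc x)
    (show (1 + ((x - 1 : ℕ) : ℝ)) - (1 + x) ≤ 0 by linarith)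
  rw [logisticGen]
  push_cast
  linarith

/-- A supersolution of the backward equation that is bounded below, nonnegative at time `0` and
nonnegative outside `A`, is nonnegative. -/
lemma nonneg_of_supersolution (hb : 0 < b) (hd : 0 < d) (hc : 0 < c) {T : ℝ} {A : Set ℕ}
    {v v' : ℝ → ℕ → ℝ} (hcont : ∀ x, ContinuousOn (fun t => v t x) (Icc 0 T))
    (hder : ∀ x ∈ A, ∀ t ∈ Ioc 0 T, HasDerivAt (fun s => v s x) (v' t x) t)
    (hsuper : ∀ x ∈ A, ∀ t ∈ Ioc 0 T, logisticGen b d c (v t) x ≤ v' t x)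
    (h0 : ∀ x, 0 ≤ v 0 x) (hA : ∀ x ∉ A, ∀ t ∈ Icc 0 T, 0 ≤ v t x)
    (hbd : ∀ x, ∀ t ∈ Icc 0 T, -1 ≤ v t x) {t : ℝ} (ht : t ∈ Icc 0 T) (x : ℕ) : 0 ≤ v t x := by
  suffices H : ∀ η > 0, ∀ t ∈ Icc 0 T, ∀ x : ℕ,
      0 < v t x + η * Real.exp ((b + 1) * t) * (1 + x) by
    refine le_of_forall_pos_le_add fun ε hε => ?_
    have hK : 0 < Real.exp ((b + 1) * t) * (1 + x) := by positivity
    have h := H (ε / (Real.exp ((b + 1) * t) * (1 + x))) (by positivity) t ht x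
    rw [mul_assoc, div_mul_cancel₀ _ hK.ne'] at h
    exact h.le
  intro η hη
  set z : ℝ → ℕ → ℝ := fun t x => v t x + η * Real.exp ((b + 1) * t) * (1 + x) with hz
  have hpos : ∀ t (x : ℕ), 0 < η * Real.exp ((b + 1) * t) * (1 + x) := fun t x => by positivity
  have zcont : ∀ x, ContinuousOn (fun t => z t x) (Icc 0 T) := fun x =>
    (hcont x).add (by fun_prop)
  obtain ⟨N, hN⟩ := exists_nat_gt (1 / η)
  have zlarge : ∀ t ∈ Icc 0 T, ∀ x : ℕ, N < x → 0 < z t x := by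
    intro t ht x hx
    have h1 := hbd x t ht
    have h2 : 1 ≤ Real.exp ((b + 1) * t) :=
      Real.one_le_exp (mul_nonneg (by positivity) ht.1)
    have h3 : (N : ℝ) < x := by exact_mod_cast hx
    have h4 : 1 < η * x := by
      rw [div_lt_iff₀ hη] at hN
      nlinarith
    have h5 : η * x ≤ η * Real.exp ((b + 1) * t) * (1 + x) := by
      have : η * 1 * x ≤ η * Real.exp ((b + 1) * t) * (1 + x) := by
        gcongr
        linarith
      linarith
    simp only [hz]
    linarith
  by_contra! hne
  obtain ⟨t₁, ht₁, x₁, hx₁⟩ := hne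
  set S : Set ℝ := ⋃ x ∈ Finset.range (N + 1), {t ∈ Icc 0 T | z t x ≤ 0} with hS
  have hSclosed : IsClosed S := by
    refine isClosed_biUnion_finset fun x _ => ?_
    exact (zcont x).preimage_isClosed_of_isClosed isClosed_Icc isClosed_Iic
  have hSsub : S ⊆ Icc 0 T := by
    intro s hs
    simp only [hS, mem_iUnion] at hs
    obtain ⟨x, _, hs⟩ := hs
    exact hs.1
  have hSmem : ∀ t ∈ Icc 0 T, ∀ x, z t x ≤ 0 → t ∈ S := by
    intro t ht x hx
    simp only [hS, mem_iUnion]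
    refine ⟨x, ?_, ht, hx⟩
    rw [Finset.mem_range, Nat.lt_succ_iff]
    by_contra! hlt
    exact absurd (zlarge t ht x hlt) (not_lt.2 hx)
  obtain ⟨τ, hτS, hτmin⟩ :=
    (isCompact_Icc.of_isClosed_subset hSclosed hSsub).exists_isLeast ⟨t₁, hSmem t₁ ht₁ x₁ hx₁⟩
  have hτ := hSsub hτS
  simp only [hS, mem_iUnion] at hτS
  obtain ⟨x, _, -, hxle⟩ := hτS
  have hxA : x ∈ A := by
    by_contra hx
    have h1 := hA x hx τ hτ
    have h2 := hpos τ x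
    simp only [hz] at hxle
    linarith
  have hτ0 : 0 < τ := by
    refine lt_of_le_of_ne hτ.1 fun h => ?_
    have h1 := h0 x
    have h2 := hpos 0 x
    simp only [hz, ← h] at hxle
    linarith
  have hbefore : ∀ s ∈ Ico 0 τ, ∀ y, 0 < z s y := by
    intro s hs y
    by_contra! hle
    exact absurd (hτmin (hSmem s ⟨hs.1, hs.2.le.trans hτ.2⟩ y hle)) (not_le.2 hs.2)
  have hev : ∀ᶠ s in nhdsWithin τ (Iio τ), s ∈ Ico 0 τ := by
    filter_upwards [Ioo_mem_nhdsLT hτ0] with s hs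
    exact ⟨hs.1.le, hs.2⟩
  have hnonneg : ∀ y, 0 ≤ z τ y := by
    intro y
    have h1 : Tendsto (fun s => z s y) (nhdsWithin τ (Iio τ)) (nhds (z τ y)) := by
      refine ((zcont y) τ hτ).mono_left ?_
      refine nhdsWithin_le_iff.2 ?_
      filter_upwards [hev] with s hs
      exact ⟨hs.1, hs.2.le.trans hτ.2⟩
    refine ge_of_tendsto h1 ?_
    filter_upwards [hev] with s hs
    exact (hbefore s hs y).le
  have hx0 : z τ x = 0 := le_antisymm hxle (hnonneg x)
  have hgen := logisticGen_nonneg_of_eq_zero hb hd hc hnonneg hx0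
  have hgen' : logisticGen b d c (z τ) x = logisticGen b d c (v τ) x
      + η * Real.exp ((b + 1) * τ) * logisticGen b d c (fun y => 1 + (y : ℝ)) x := by
    simp only [hz]
    rw [logisticGen_add, logisticGen_const_mul]
  have hzder : HasDerivAt (fun s => z s x)
      (v' τ x + η * (Real.exp ((b + 1) * τ) * (b + 1)) * (1 + x)) τ := by
    have h1 : HasDerivAt (fun s : ℝ => (b + 1) * s) (b + 1) τ := by
      simpa using (hasDerivAt_id τ).const_mul (b + 1)
    exact (hder x hxA τ ⟨hτ0, hτ.2⟩).add ((h1.exp.const_mul η).mul_const _)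
  have hlt : 0 < v' τ x + η * (Real.exp ((b + 1) * τ) * (b + 1)) * (1 + x) := by
    have h1 := hsuper x hxA τ ⟨hτ0, hτ.2⟩
    have he : 0 < η * Real.exp ((b + 1) * τ) := by positivity
    have h2 := mul_le_mul_of_nonneg_left (logisticGen_one_add_le (b := b) hd hc x) he.le
    have h3 : 0 < η * Real.exp ((b + 1) * τ) * (1 + b + x) := by positivity
    nlinarith
  have hle : v' τ x + η * (Real.exp ((b + 1) * τ) * (b + 1)) * (1 + x) ≤ 0 := by
    have h1 := (hasDerivWithinAt_iff_tendsto_slope' self_notMem_Iio).1 (hzder.hasDerivWithinAt (s := Iio τ))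
    refine le_of_tendsto h1 ?_
    filter_upwards [hev] with s hs
    rw [slope_def_field, hx0]
    refine div_nonpos_of_nonneg_of_nonpos ?_ ?_ <;> linarith [hbefore s hs x, hs.2]
  exact absurd hlt (not_lt.2 hle)

end MinimumPrinciple

/-! ### Estimates for the logistic process -/

section Estimates

variable {M : AbsorbedProcess Ω} {b d c : ℝ}

lemma logisticGen_div_le (hb : 0 < b) (hd : 0 < d) (hc : 0 < c) {a : ℝ} (ha : 0 ≤ a) (x : ℕ) :
    logisticGen b d c (fun y => (y : ℝ) / (1 + a * y)) x
      ≤ (b + c) * ((x : ℝ) / (1 + a * x)) - c * x ^ 2 / (1 + a * x) ^ 2 := by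
  rcases x with _ | n
  · simp [logisticGen]
  have hD : 0 ≤ d * ((n : ℝ) + 1) + c * (n + 1) * n := by positivity
  have h1 : ((n : ℝ) + 1 + 1) / (1 + a * (n + 1 + 1)) - (n + 1) / (1 + a * (n + 1))
      ≤ 1 / (1 + a * (n + 1)) := by
    rw [← sub_nonneg]
    have : 1 / (1 + a * ((n : ℝ) + 1)) - (((n : ℝ) + 1 + 1) / (1 + a * (n + 1 + 1))
        - (n + 1) / (1 + a * (n + 1))) = a * (n + 1 + 1) /
          ((1 + a * (n + 1)) * (1 + a * (n + 1 + 1))) := by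
      field_simp
      ring
    rw [this]
    positivity
  have h2 : (n : ℝ) / (1 + a * n) - (n + 1) / (1 + a * (n + 1))
      ≤ -(1 / (1 + a * (n + 1)) ^ 2) := by
    rw [← sub_nonneg]
    have : -(1 / (1 + a * ((n : ℝ) + 1)) ^ 2) - ((n : ℝ) / (1 + a * n)
        - (n + 1) / (1 + a * (n + 1))) = a / ((1 + a * n) * (1 + a * (n + 1)) ^ 2) := by
      field_simp
      ring
    rw [this]
    positivity
  have h3 := mul_le_mul_of_nonneg_left h1 (show 0 ≤ b * ((n : ℝ) + 1) by positivity)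
  have h4 := mul_le_mul_of_nonneg_left h2 hD
  have h5 : 0 ≤ b * ((n + 1 : ℝ) / (1 + a * (n + 1))) + c * ((n + 1 : ℝ) / (1 + a * (n + 1)))
      - c * (n + 1) ^ 2 / (1 + a * (n + 1)) ^ 2 - (b * (n + 1) * (1 / (1 + a * (n + 1)))
      + (d * (n + 1) + c * (n + 1) * n) * -(1 / (1 + a * (n + 1)) ^ 2)) := by
    have : b * ((n + 1 : ℝ) / (1 + a * (n + 1))) + c * ((n + 1 : ℝ) / (1 + a * (n + 1)))
      - c * (n + 1) ^ 2 / (1 + a * (n + 1)) ^ 2 - (b * (n + 1) * (1 / (1 + a * (n + 1)))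
      + (d * (n + 1) + c * (n + 1) * n) * -(1 / (1 + a * (n + 1)) ^ 2))
      = (d * (n + 1) + c * a * (n + 1) ^ 2) / (1 + a * (n + 1)) ^ 2 := by
      field_simp
      ring
    rw [this]
    positivity
  simp only [logisticGen, Nat.add_sub_cancel]
  push_cast
  rw [add_sub_cancel_right]
  linarith

/-- The process comes down from infinity. -/
lemma occ_Ioi_le (hb : 0 < b) (hd : 0 < d) (hc : 0 < c) (hQ : IsRateMatrixOf M (Qlog b d c))
    {m : ℕ} (hm : m ≠ 0) {t : ℝ} (ht : 0 < t) (x : ℕ) :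
    occ M (Ioi m) t x ≤ Real.exp ((b + c) * t) / (c * t * m) := by
  have hm' : (0 : ℝ) < m := by exact_mod_cast Nat.pos_of_ne_zero hm
  have hpos : ∀ s ∈ Icc 0 t, ∀ x : ℕ, 0 < 1 + c * s * x := fun s hs x => by
    have := hs.1
    positivity
  have hF : ∀ s ∈ Icc 0 t, ∀ x : ℕ, HasDerivAt (fun s : ℝ => (x : ℝ) / (1 + c * s * x))
      (-(c * x ^ 2 / (1 + c * s * x) ^ 2)) s := by
    intro s hs x
    have h1 : HasDerivAt (fun s : ℝ => 1 + c * s * x) (c * x) s := by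
      simpa using (((hasDerivAt_id s).const_mul c).mul_const (x : ℝ)).const_add 1
    refine ((hasDerivAt_const s (x : ℝ)).div h1 (hpos s hs x).ne').congr_deriv ?_
    ring
  have hw : ∀ s ∈ Icc 0 t, ∀ x : ℕ, HasDerivAt
      (fun s : ℝ => (m : ℝ)⁻¹ * Real.exp ((b + c) * s) * ((x : ℝ) / (1 + c * s * x)))
      ((m : ℝ)⁻¹ * Real.exp ((b + c) * s) * ((b + c) * ((x : ℝ) / (1 + c * s * x))
        - c * x ^ 2 / (1 + c * s * x) ^ 2)) s := by
    intro s hs x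
    have h1 : HasDerivAt (fun s : ℝ => (b + c) * s) (b + c) s := by
      simpa using (hasDerivAt_id s).const_mul (b + c)
    refine ((h1.exp.const_mul (m : ℝ)⁻¹).mul (hF s hs x)).congr_deriv ?_
    ring
  have key := nonneg_of_supersolution hb hd hc (T := t) (A := univ)
    (v := fun s x => (m : ℝ)⁻¹ * Real.exp ((b + c) * s) * ((x : ℝ) / (1 + c * s * x))
      - occ M (Ioi m) s x)
    (v' := fun s x => (m : ℝ)⁻¹ * Real.exp ((b + c) * s) * ((b + c) * ((x : ℝ) / (1 + c * s * x))
        - c * x ^ 2 / (1 + c * s * x) ^ 2) - logisticGen b d c (occ M (Ioi m) s) x)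
    (fun x s hs => ((hw s hs x).continuousAt.sub
      (continuous_occ hQ _ x).continuousAt).continuousWithinAt)
    (fun x _ s hs => (hw s ⟨hs.1.le, hs.2⟩ x).sub (hasDerivAt_occ hQ _ hs.1 x))
    (fun x _ s hs => ?_) (fun x => ?_) (fun x hx => absurd (mem_univ x) hx) (fun x s hs => ?_)
    (t := t) ⟨ht.le, le_rfl⟩ x
  · have h1 : (x : ℝ) / (1 + c * t * x) ≤ 1 / (c * t) := by
      rw [div_le_div_iff₀ (hpos t ⟨ht.le, le_rfl⟩ x) (by positivity)]
      nlinarith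
    have h2 : (m : ℝ)⁻¹ * Real.exp ((b + c) * t) * ((x : ℝ) / (1 + c * t * x))
        ≤ (m : ℝ)⁻¹ * Real.exp ((b + c) * t) * (1 / (c * t)) :=
      mul_le_mul_of_nonneg_left h1 (by positivity)
    have h3 : (m : ℝ)⁻¹ * Real.exp ((b + c) * t) * (1 / (c * t))
        = Real.exp ((b + c) * t) / (c * t * m) := by
      field_simp
    linarith
  · have hs0 : 0 ≤ c * s := mul_nonneg hc.le hs.1.le
    rw [logisticGen_sub, logisticGen_const_mul]
    gcongr
    exact logisticGen_div_le hb hd hc hs0 x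
  · rw [occ_zero]
    by_cases hx : x ∈ Ioi m
    · have h1 : (m : ℝ) ≤ x := by exact_mod_cast (mem_Ioi.1 hx).le
      have h2 : 1 ≤ (m : ℝ)⁻¹ * x := by
        rw [inv_mul_eq_div, one_le_div hm']
        exact h1
      simpa [indicator_of_mem hx] using h2
    · rw [indicator_of_notMem hx, sub_zero]
      simp only [mul_zero, zero_mul, add_zero]
      positivity
  · have h1 := hpos s hs x
    have h2 := occ_le_one M (Ioi m) s x
    have h3 : 0 ≤ (m : ℝ)⁻¹ * Real.exp ((b + c) * s) * ((x : ℝ) / (1 + c * s * x)) := by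
      positivity
    linarith

lemma exists_occ_Ioi_le (hb : 0 < b) (hd : 0 < d) (hc : 0 < c)
    (hQ : IsRateMatrixOf M (Qlog b d c)) {t ε : ℝ} (ht : 0 < t) (hε : 0 < ε) :
    ∃ m : ℕ, m ≠ 0 ∧ ∀ x, occ M (Ioi m) t x ≤ ε := by
  obtain ⟨m, hm⟩ := exists_nat_gt (Real.exp ((b + c) * t) / (c * t) / ε)
  have hm0 : (0 : ℝ) < m := lt_trans (by positivity) hm
  have hm1 : m ≠ 0 := by
    rintro rfl
    simp at hm0
  refine ⟨m, hm1, fun x => (occ_Ioi_le hb hd hc hQ hm1 ht x).trans ?_⟩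
  rw [div_lt_iff₀ hε] at hm
  rw [← div_div, div_le_iff₀ hm0]
  linarith

/-- Absorption is most likely when started from `1`. -/
lemma occ_absorbed_le (hb : 0 < b) (hd : 0 < d) (hc : 0 < c)
    (hQ : IsRateMatrixOf M (Qlog b d c)) {t : ℝ} (ht : 0 ≤ t) {x : ℕ} (hx : x ≠ 0) :
    occ M {0} t x ≤ occ M {0} t 1 := by
  have key := nonneg_of_supersolution hb hd hc (T := t) (A := Ici 2)
    (v := fun s x => occ M {0} t 1 - occ M {0} s (max x 1))
    (v' := fun s x => - logisticGen b d c (occ M {0} s) (max x 1))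
    (fun x => (continuous_const.sub (continuous_occ hQ _ _)).continuousOn)
    (fun x _ s hs => (hasDerivAt_occ hQ _ hs.1 _).const_sub _)
    (fun x hx s hs => ?_) (fun x => ?_) (fun x hx s hs => ?_) (fun x s hs => ?_)
    (t := t) ⟨ht, le_rfl⟩ x
  · have : max x 1 = x := by omega
    rw [this] at key
    linarith
  · rw [mem_Ici] at hx
    have h1 : max x 1 = x := by omega
    have h2 : max (x + 1) 1 = x + 1 := by omega
    have h3 : max (x - 1) 1 = x - 1 := by omega
    simp only [logisticGen, h1, h2, h3]
    exact le_of_eq (by ring)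
  · have : max x 1 ≠ 0 := by omega
    simp [occ_zero, this, occ_nonneg]
  · have h1 : max x 1 = 1 := by
      rw [mem_Ici] at hx
      omega
    have h2 := occ_survival_antitone M hs.1 hs.2 1
    rw [occ_compl, occ_compl] at h2
    rw [h1]
    linarith
  · have := occ_nonneg M {0} t 1
    have := occ_le_one M {0} s (max x 1)
    linarith

lemma exp_le_occ_self (hb : 0 < b) (hd : 0 < d) (hc : 0 < c) (hQ : IsRateMatrixOf M (Qlog b d c))
    {t : ℝ} (ht : 0 ≤ t) (x : ℕ) :
    Real.exp (-((b * x + (d * x + c * x * ((x : ℝ) - 1))) * t)) ≤ occ M {x} t x := by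
  have hD := deathRate_nonneg hd hc x
  set q := b * x + (d * x + c * x * ((x : ℝ) - 1)) with hq
  have hder : ∀ s : ℝ, 0 < s → HasDerivAt (fun s => Real.exp (q * s) * occ M {x} s x)
      (Real.exp (q * s) * q * occ M {x} s x
        + Real.exp (q * s) * logisticGen b d c (occ M {x} s) x) s := by
    intro s hs
    have h1 : HasDerivAt (fun s : ℝ => q * s) q s := by
      simpa using (hasDerivAt_id s).const_mul q
    exact h1.exp.mul (hasDerivAt_occ hQ _ hs x)
  have hmono : MonotoneOn (fun s => Real.exp (q * s) * occ M {x} s x) (Ici 0) := by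
    refine monotoneOn_of_deriv_nonneg (convex_Ici 0) ?_ ?_ ?_
    · exact (Continuous.mul (by fun_prop) (continuous_occ hQ _ x)).continuousOn
    · intro s hs
      rw [interior_Ici] at hs
      exact (hder s hs).differentiableAt.differentiableWithinAt
    · intro s hs
      rw [interior_Ici] at hs
      rw [(hder s hs).deriv]
      have h1 : 0 ≤ b * x * occ M {x} s (x + 1) := mul_nonneg (by positivity) (occ_nonneg ..)
      have h2 : 0 ≤ (d * x + c * x * ((x : ℝ) - 1)) * occ M {x} s (x - 1) :=
        mul_nonneg hD (occ_nonneg ..)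
      have h3 : 0 ≤ q * occ M {x} s x + logisticGen b d c (occ M {x} s) x := by
        rw [logisticGen, hq]
        linarith
      have h4 := mul_nonneg (Real.exp_pos (q * s)).le h3
      linarith
  have h := hmono (mem_Ici.2 le_rfl) (mem_Ici.2 ht) ht
  simp only [occ_zero, mul_zero, Real.exp_zero, one_mul, mem_singleton_iff, indicator_of_mem,
    Pi.one_apply] at h
  rw [Real.exp_neg, inv_le_iff_one_le_mul₀ (Real.exp_pos _), mul_comm]
  exact h

lemma occ_self_pos (hb : 0 < b) (hd : 0 < d) (hc : 0 < c) (hQ : IsRateMatrixOf M (Qlog b d c))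
    {t : ℝ} (ht : 0 ≤ t) (x : ℕ) : 0 < occ M {x} t x :=
  (Real.exp_pos _).trans_le (exp_le_occ_self hb hd hc hQ ht x)

lemma occ_pos_of_rate_pos (hb : 0 < b) (hd : 0 < d) (hc : 0 < c)
    (hQ : IsRateMatrixOf M (Qlog b d c)) {t : ℝ} (ht : 0 < t) {x y : ℕ} (hxy : x ≠ y)
    (hr : 0 < Qlog b d c x y) : 0 < occ M {y} t x := by
  have h1 := (hasDerivWithinAt_occ_zero hQ x y).Ioi_of_Ici
  rw [hasDerivWithinAt_iff_tendsto_slope' self_notMem_Ioi] at h1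
  obtain ⟨h, hh, hh0, hht⟩ :=
    ((h1.eventually_const_lt hr).and (Ioo_mem_nhdsGT ht)).exists
  have h2 : 0 < occ M {y} h x := by
    rw [slope_def_field, occ_zero, indicator_of_notMem (by simpa using hxy), sub_zero,
      sub_zero] at hh
    exact (div_pos_iff_of_pos_right hh0).1 hh
  have h3 := occ_mul_le M {y} hh0.le (sub_nonneg.2 hht.le) x y
  rw [add_sub_cancel] at h3
  exact (mul_pos h2 (occ_self_pos hb hd hc hQ (sub_nonneg.2 hht.le) y)).trans_le h3

lemma occ_pos (hb : 0 < b) (hd : 0 < d) (hc : 0 < c) (hQ : IsRateMatrixOf M (Qlog b d c))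
    {x y : ℕ} (hx : x ≠ 0) (hy : y ≠ 0) {t : ℝ} (ht : 0 < t) : 0 < occ M {y} t x := by
  have trans_pos : ∀ {x y z : ℕ}, (∀ t > 0, 0 < occ M {y} t x) → (∀ t > 0, 0 < occ M {z} t y) →
      ∀ t > 0, 0 < occ M {z} t x := by
    intro x y z h1 h2 t ht
    have h := occ_mul_le M {z} (half_pos ht).le (half_pos ht).le x y
    rw [add_halves] at h
    exact (mul_pos (h1 _ (half_pos ht)) (h2 _ (half_pos ht))).trans_le h
  have up : ∀ n : ℕ, ∀ t > 0, 0 < occ M {x + n} t x := by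
    intro n
    induction n with
    | zero => exact fun t ht => occ_self_pos hb hd hc hQ ht.le x
    | succ n ih =>
      refine trans_pos ih fun t ht => occ_pos_of_rate_pos hb hd hc hQ ht (by omega) ?_
      have : x + n ≠ 0 := by omega
      rw [Qlog, if_neg this, if_pos (by omega)]
      have : (0 : ℝ) < ((x + n : ℕ) : ℝ) := by exact_mod_cast Nat.pos_of_ne_zero this
      positivity
  have down : ∀ n : ℕ, ∀ t > 0, 0 < occ M {y} t (y + n) := by
    intro n
    induction n with
    | zero => exact fun t ht => occ_self_pos hb hd hc hQ ht.le y
    | succ n ih =>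
      refine trans_pos (fun t ht => occ_pos_of_rate_pos hb hd hc hQ ht (by omega) ?_) ih
      rw [Qlog, if_neg (by omega), if_neg (by omega), if_pos (by omega)]
      push_cast
      have : (0 : ℝ) < y := by exact_mod_cast Nat.pos_of_ne_zero hy
      have : 0 ≤ (y : ℝ) + (n + 1) - 1 := by
        have : (0 : ℝ) ≤ n := n.cast_nonneg
        linarith
      positivity
  rcases le_total x y with h | h
  · obtain ⟨n, rfl⟩ := Nat.exists_eq_add_of_le h
    exact up n t ht
  · obtain ⟨n, rfl⟩ := Nat.exists_eq_add_of_le h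
    exact down n t ht

lemma exists_le_occ (hb : 0 < b) (hd : 0 < d) (hc : 0 < c) (hQ : IsRateMatrixOf M (Qlog b d c))
    {m : ℕ} (hm : m ≠ 0) {t : ℝ} (ht : 0 < t) :
    ∃ ε > 0, ∀ x ∈ Icc 1 m, ∀ y ∈ Icc 1 m, ε ≤ occ M {y} t x := by
  obtain ⟨p, hp, hmin⟩ := Finset.exists_min_image (Finset.Icc 1 m ×ˢ Finset.Icc 1 m)
    (fun p => occ M {p.2} t p.1) ⟨(1, 1), by simp; omega⟩
  simp only [Finset.mem_product, Finset.mem_Icc] at hp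
  refine ⟨occ M {p.2} t p.1, occ_pos hb hd hc hQ (by omega) (by omega) ht, fun x hx y hy => ?_⟩
  exact hmin (x, y) (by simpa using ⟨hx, hy⟩)

lemma occ_eq_zero_add_Icc_add_Ioi (M : AbsorbedProcess Ω) (m : ℕ) (t : ℝ) (x : ℕ) :
    occ M {0} t x + occ M (Icc 1 m) t x + occ M (Ioi m) t x = 1 := by
  rw [← occ_union, ← occ_union, ← occ_univ M t x]
  · congr 1
    ext n
    simp
    omega
  · refine Set.disjoint_left.2 fun n hn h => ?_
    simp at hn h
    omega
  · simp

lemma mul_occ_Icc_le (M : AbsorbedProcess Ω) {m : ℕ} {s t ε : ℝ} (hs : 0 ≤ s) (ht : 0 ≤ t)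
    {E : Set ℕ} (hε : ∀ y ∈ Icc 1 m, ε ≤ occ M E t y) (x : ℕ) :
    ε * occ M (Icc 1 m) s x ≤ occ M E (s + t) x := by
  rw [← Finset.coe_Icc, occ_coe_finset, Finset.mul_sum]
  refine le_trans (Finset.sum_le_sum fun y hy => ?_)
    (sum_le_hasSum (Finset.Icc 1 m) (fun _ _ => mul_nonneg (occ_nonneg ..) (occ_nonneg ..))
      (hasSum_occ_add M E hs ht x))
  rw [mul_comm]
  exact mul_le_mul_of_nonneg_left (hε y (by simpa using hy)) (occ_nonneg ..)

lemma exists_le_occ_one (hb : 0 < b) (hd : 0 < d) (hc : 0 < c)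
    (hQ : IsRateMatrixOf M (Qlog b d c)) :
    ∃ ε > 0, ∀ x : ℕ, x ≠ 0 → ε ≤ occ M {1} 1 x := by
  have hδ : 0 < 1 - occ M {0} (1 / 2) 1 := by
    rw [← occ_compl]
    exact (occ_self_pos hb hd hc hQ one_half_pos.le 1).trans_le (occ_mono M (by simp) _ _)
  obtain ⟨m, hm, hm'⟩ := exists_occ_Ioi_le hb hd hc hQ one_half_pos (half_pos hδ)
  obtain ⟨ε, hε, hε'⟩ := exists_le_occ hb hd hc hQ hm one_half_pos
  refine ⟨ε * ((1 - occ M {0} (1 / 2) 1) / 2), by positivity, fun x hx => ?_⟩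
  have h1 := occ_eq_zero_add_Icc_add_Ioi M m (1 / 2) x
  have h2 := occ_absorbed_le hb hd hc hQ one_half_pos.le hx
  have h3 := mul_occ_Icc_le M one_half_pos.le one_half_pos.le
    (fun y hy => hε' y hy 1 ⟨le_rfl, by omega⟩) x
  rw [add_halves] at h3
  refine le_trans (mul_le_mul_of_nonneg_left ?_ hε.le) h3
  linarith [hm' x]

end Estimates

/-! ### Hypothesis (H) -/

section HypothesisH

/-- Trajectories that stay above `m` at the integer times `1, …, n`. -/
def aboveAt (m n : ℕ) : Set (ℝ≥0 → ℕ) := {f | ∀ k < n, m < f (1 + k)}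

lemma measurableSet_aboveAt (m n : ℕ) : MeasurableSet (aboveAt m n) := by
  have : aboveAt m n = ⋂ k, ⋂ (_ : k < n), (fun f : ℝ≥0 → ℕ => f (1 + k)) ⁻¹' Ioi m := by
    ext f
    simp [aboveAt]
  rw [this]
  exact MeasurableSet.iInter fun k => MeasurableSet.iInter fun _ =>
    measurable_pi_apply (1 + k : ℝ≥0) MeasurableSet.of_discrete

lemma P_aboveAt_le {M : AbsorbedProcess Ω} {m : ℕ} {ε : ℝ}
    (hm : ∀ x, occ M (Ioi m) 1 x ≤ ε) (n x : ℕ) :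
    M.P x {ω | (fun u => M.X u ω) ∈ aboveAt m n} ≤ ENNReal.ofReal ε ^ n := by
  induction n generalizing x with
  | zero =>
    have := M.prob x
    simpa using prob_le_one
  | succ n ih =>
    have hsub : {ω | (fun u => M.X u ω) ∈ aboveAt m (n + 1)} ⊆
        ⋃ y : Ioi m, ({ω | M.X 1 ω = y} ∩ {ω | (fun u => M.X (1 + u) ω) ∈ aboveAt m n}) := by
      intro ω hω
      have h0 : m < M.X 1 ω := by simpa using hω 0 (Nat.succ_pos n)
      refine mem_iUnion.2 ⟨⟨M.X 1 ω, h0⟩, rfl, fun k hk => ?_⟩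
      have h1 := hω (k + 1) (Nat.succ_lt_succ hk)
      push_cast at h1
      rwa [add_comm (k : ℝ≥0)] at h1
    have hone : M.P x (M.X 1 ⁻¹' Ioi m) ≤ ENNReal.ofReal ε := by
      have h := ofReal_occ M (Ioi m) 1 x
      rw [Real.toNNReal_one] at h
      rw [← h]
      exact ENNReal.ofReal_le_ofReal (hm x)
    calc M.P x {ω | (fun u => M.X u ω) ∈ aboveAt m (n + 1)}
        ≤ ∑' y : Ioi m, M.P x
            ({ω | M.X 1 ω = y} ∩ {ω | (fun u => M.X (1 + u) ω) ∈ aboveAt m n}) :=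
          (measure_mono hsub).trans (measure_iUnion_le _)
      _ ≤ ∑' y : Ioi m, M.P x (M.X 1 ⁻¹' {(y : ℕ)}) * ENNReal.ofReal ε ^ n := by
          refine ENNReal.tsum_le_tsum fun y => ?_
          rw [M.markov x y 1 _ (measurableSet_aboveAt m n)]
          exact mul_le_mul_right (ih y) _
      _ = M.P x (M.X 1 ⁻¹' Ioi m) * ENNReal.ofReal ε ^ n := by
          rw [ENNReal.tsum_mul_right, tsum_measure_preimage_singleton (to_countable _)
            fun y _ => measurableSet_occ M {y} 1]
      _ ≤ ENNReal.ofReal ε ^ (n + 1) := by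
          rw [pow_succ']
          exact mul_le_mul_left hone _

lemma notMem_of_lt_hitT (M : AbsorbedProcess Ω) {K : Set ℕ} {ω : Ω} {t : ℝ≥0}
    (h : (t : ℝ≥0∞) < hitT M K ω) : M.X t ω ∉ K := fun hK =>
  absurd (iInf_le _ (⟨t, hK⟩ : {t : ℝ≥0 // M.X t ω ∈ K})) (not_le.2 h)

lemma lt_X_of_lt_hitT (M : AbsorbedProcess Ω) {m : ℕ} {ω : Ω} {t : ℝ≥0}
    (h : (t : ℝ≥0∞) < min (hitT M (Icc 1 m) ω) (hitT M {0} ω)) : m < M.X t ω := by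
  have h1 := notMem_of_lt_hitT M (h.trans_le (min_le_left _ _))
  have h2 := notMem_of_lt_hitT M (h.trans_le (min_le_right _ _))
  simp only [mem_Icc, mem_singleton_iff] at h1 h2
  omega

lemma expE_hitT_le (M : AbsorbedProcess Ω) (m : ℕ) {l : ℝ} (hl : 0 < l) (ω : Ω) :
    expE l (min (hitT M (Icc 1 m) ω) (hitT M {0} ω)) ≤
      ∑' n : ℕ, {ω | (fun u => M.X u ω) ∈ aboveAt m n}.indicator
        (fun _ => ENNReal.ofReal (Real.exp (l * (n + 2)))) ω := by
  have habove : ∀ n : ℕ, (n : ℝ≥0∞) < min (hitT M (Icc 1 m) ω) (hitT M {0} ω) →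
      (fun u => M.X u ω) ∈ aboveAt m n := by
    intro n hn k hk
    refine lt_X_of_lt_hitT M (lt_of_le_of_lt ?_ hn)
    have : 1 + k ≤ n := by omega
    exact_mod_cast this
  generalize min (hitT M (Icc 1 m) ω) (hitT M {0} ω) = τ at habove
  rw [expE]
  split_ifs with hτ
  · have hterm : ∀ n : ℕ, 1 ≤ {ω | (fun u => M.X u ω) ∈ aboveAt m n}.indicator
        (fun _ => ENNReal.ofReal (Real.exp (l * (n + 2)))) ω := by
      intro n
      rw [indicator_of_mem (s := {ω | (fun u => M.X u ω) ∈ aboveAt m n})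
        (habove n (by simp [hτ])), ← ENNReal.ofReal_one]
      exact ENNReal.ofReal_le_ofReal (Real.one_le_exp (by positivity))
    refine le_trans (le_of_eq ?_) (ENNReal.tsum_le_tsum hterm)
    rw [ENNReal.tsum_const_eq_top_of_ne_zero one_ne_zero]
  · set n := ⌈τ.toReal⌉₊ - 1 with hn
    have hle : τ.toReal ≤ n + 2 := by
      have h1 := Nat.le_ceil τ.toReal
      have h2 : ⌈τ.toReal⌉₊ ≤ n + 1 := by omega
      have h3 : (⌈τ.toReal⌉₊ : ℝ) ≤ n + 1 := by exact_mod_cast h2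
      linarith
    have hmem : (fun u => M.X u ω) ∈ aboveAt m n := by
      rcases Nat.eq_zero_or_pos n with h0 | h0
      · rw [h0]
        intro k hk
        omega
      · refine habove n ?_
        have h1 : (n : ℝ) < τ.toReal := Nat.lt_ceil.1 (by omega)
        rwa [← ENNReal.ofReal_lt_iff_lt_toReal n.cast_nonneg hτ, ENNReal.ofReal_natCast] at h1
    refine le_trans ?_ (ENNReal.le_tsum n)
    rw [indicator_of_mem (s := {ω | (fun u => M.X u ω) ∈ aboveAt m n}) hmem]
    gcongr

lemma lintegral_expE_hitT_le {M : AbsorbedProcess Ω} {m : ℕ} {l : ℝ} (hl : 0 < l)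
    (hm : ∀ x, occ M (Ioi m) 1 x ≤ Real.exp (-l) / 2) (x : ℕ) :
    ∫⁻ ω, expE l (min (hitT M (Icc 1 m) ω) (hitT M {0} ω)) ∂ M.P x
      ≤ ENNReal.ofReal (2 * Real.exp (2 * l)) := by
  have hmeas : ∀ n, MeasurableSet {ω | (fun u => M.X u ω) ∈ aboveAt m n} := fun n =>
    measurable_pi_lambda _ (fun u => M.meas u) (measurableSet_aboveAt m n)
  calc ∫⁻ ω, expE l (min (hitT M (Icc 1 m) ω) (hitT M {0} ω)) ∂ M.P x
      ≤ ∫⁻ ω, ∑' n : ℕ, {ω | (fun u => M.X u ω) ∈ aboveAt m n}.indicator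
        (fun _ => ENNReal.ofReal (Real.exp (l * (n + 2)))) ω ∂ M.P x :=
        lintegral_mono fun ω => expE_hitT_le M m hl ω
    _ = ∑' n : ℕ, ENNReal.ofReal (Real.exp (l * (n + 2))) *
          M.P x {ω | (fun u => M.X u ω) ∈ aboveAt m n} := by
        rw [lintegral_tsum fun n => (measurable_const.indicator (hmeas n)).aemeasurable]
        exact tsum_congr fun n => lintegral_indicator_const (hmeas n) _
    _ ≤ ∑' n : ℕ, ENNReal.ofReal (Real.exp (2 * l) * (1 / 2) ^ n) := by
        refine ENNReal.tsum_le_tsum fun n => ?_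
        refine (mul_le_mul_right (P_aboveAt_le hm n x) _).trans (le_of_eq ?_)
        rw [← ENNReal.ofReal_pow (by positivity), ← ENNReal.ofReal_mul (by positivity)]
        congr 1
        rw [div_eq_mul_one_div, mul_pow, ← mul_assoc, ← Real.exp_nat_mul, ← Real.exp_add]
        congr 2
        ring
    _ = ENNReal.ofReal (2 * Real.exp (2 * l)) := by
        rw [← ENNReal.ofReal_tsum_of_nonneg (fun n => by positivity)
          (summable_geometric_two.mul_left _), tsum_mul_left, tsum_geometric_two, mul_comm]

variable {M : AbsorbedProcess Ω} {b d c : ℝ}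

lemma exists_hypH (hb : 0 < b) (hd : 0 < d) (hc : 0 < c)
    (hQ : IsRateMatrixOf M (Qlog b d c)) :
    ∃ (K : Set ℕ) (x0 : ℕ) (c1 c2 c3 c4 l0 : ℝ), HypH M K x0 c1 c2 c3 c4 l0 := by
  obtain ⟨m, hm, hm'⟩ := exists_occ_Ioi_le hb hd hc hQ one_pos
    (show 0 < Real.exp (-(b + d)) / 2 by positivity)
  obtain ⟨c1, hc1, hc1'⟩ := exists_le_occ_one hb hd hc hQ
  obtain ⟨c2, hc2, hc2'⟩ := exists_le_occ hb hd hc hQ hm one_pos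
  refine ⟨Icc 1 m, 1, c1, c2, 1, 2 * Real.exp (2 * (b + d)), b + d, by simp,
    by simpa using Nat.one_le_iff_ne_zero.2 hm, hc1, hc2, one_pos, by positivity, by positivity,
    fun x hx => ?_, fun t x hx y hy => ?_, fun t => ?_,
    fun x _ => lintegral_expE_hitT_le (by positivity) hm' x⟩
  · have := M.prob x
    have h1 : M.P x ({ω | M.X 1 ω = 1} ∩ alive M 1) = M.P x (M.X 1 ⁻¹' {1}) := by
      refine measure_congr (eventuallyEq_set.2 ?_)
      filter_upwards [eventuallyEq_set.1 (alive_ae_eq M 1 x)] with ω hω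
      rw [mem_inter_iff, hω]
      simp +contextual
    have h2 := ofReal_occ M {1} 1 x
    rw [Real.toNNReal_one] at h2
    rw [h1, ← h2]
    exact (mul_le_of_le_one_right' prob_le_one).trans (ENNReal.ofReal_le_ofReal (hc1' x hx))
  · rw [P_alive, P_alive, ← ENNReal.ofReal_mul hc2.le]
    refine ENNReal.ofReal_le_ofReal ?_
    calc c2 * occ M {0}ᶜ t y ≤ occ M {y} 1 x * occ M {0}ᶜ t y :=
          mul_le_mul_of_nonneg_right (hc2' x hx y hy) (occ_nonneg ..)
      _ ≤ occ M {0}ᶜ (1 + t) x := occ_mul_le M _ zero_le_one t.2 x y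
      _ ≤ occ M {0}ᶜ t x := occ_survival_antitone M t.2 (by simp) x
  · have h1 := ofReal_occ M (Icc 1 m) t 1
    rw [Real.toNNReal_coe] at h1
    change _ ≤ M.P 1 (M.X t ⁻¹' Icc 1 m)
    rw [← h1]
    refine ENNReal.ofReal_le_ofReal ?_
    have h2 := exp_le_occ_self hb hd hc hQ t.2 1
    refine le_trans (le_of_eq ?_) (h2.trans (occ_mono M ?_ _ _))
    · simp
    · simpa using Nat.one_le_iff_ne_zero.2 hm

end HypothesisH

/-! ### Contraction of the conditioned process -/

section Contraction

variable {M : AbsorbedProcess Ω} {b d c : ℝ}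

/-- Survival from `1` is comparable with survival from any state. -/
lemma exists_survival_le (hb : 0 < b) (hd : 0 < d) (hc : 0 < c)
    (hQ : IsRateMatrixOf M (Qlog b d c)) :
    ∃ R > 0, ∀ t : ℝ, 0 ≤ t → ∀ x, occ M {0}ᶜ t x ≤ R * occ M {0}ᶜ t 1 := by
  obtain ⟨m, hm, hm'⟩ := exists_occ_Ioi_le hb hd hc hQ one_pos
    (show 0 < Real.exp (-(b + d)) / 2 by positivity)
  obtain ⟨ε, hε, hε'⟩ := exists_le_occ hb hd hc hQ hm one_pos
  set R := (2 * ε⁻¹ + 1) * Real.exp (b + d) with hR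
  have hRpos : 0 < R := by positivity
  have hself : ∀ t : ℝ, 0 ≤ t → Real.exp (-((b + d) * t)) ≤ occ M {0}ᶜ t 1 := by
    intro t ht
    refine le_trans (le_of_eq ?_) ((exp_le_occ_self hb hd hc hQ ht 1).trans
      (occ_mono M (by simp) _ _))
    simp
  have hshort : ∀ t : ℝ, 0 ≤ t → t ≤ 1 → ∀ x, occ M {0}ᶜ t x ≤ R * occ M {0}ᶜ t 1 := by
    intro t ht ht1 x
    have h1 : Real.exp (-(b + d)) ≤ occ M {0}ᶜ t 1 := by
      refine le_trans (Real.exp_le_exp.2 ?_) (hself t ht)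
      nlinarith
    have h2 : 1 ≤ R * Real.exp (-(b + d)) := by
      rw [hR, mul_assoc, ← Real.exp_add, add_neg_cancel, Real.exp_zero]
      have : 0 < ε⁻¹ := by positivity
      linarith
    linarith [occ_le_one M {0}ᶜ t x, mul_le_mul_of_nonneg_left h1 hRpos.le]
  have hstep : ∀ t : ℝ, 0 ≤ t → (∀ x, occ M {0}ᶜ t x ≤ R * occ M {0}ᶜ t 1) →
      ∀ x, occ M {0}ᶜ (1 + t) x ≤ R * occ M {0}ᶜ (1 + t) 1 := by
    intro t ht ih x
    set g := occ M {0}ᶜ t 1 with hg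
    have hg0 : 0 ≤ g := occ_nonneg ..
    have hlow : ∀ y ∈ Icc 1 m, occ M {0}ᶜ t y ≤ ε⁻¹ * g := by
      intro y hy
      have h1 := occ_mul_le M {0}ᶜ zero_le_one ht 1 y
      have h2 := occ_survival_antitone M ht (show t ≤ 1 + t by linarith) 1
      have h3 := mul_le_mul_of_nonneg_right (hε' 1 ⟨le_rfl, by omega⟩ y hy)
        (occ_nonneg M {0}ᶜ t y)
      rw [inv_mul_eq_div, le_div_iff₀ hε]
      linarith
    have hIoi := hasSum_occ_add M (Ioi m) zero_le_one le_rfl x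
    rw [add_zero] at hIoi
    have hup : occ M {0}ᶜ (1 + t) x ≤ 1 * (ε⁻¹ * g) + occ M (Ioi m) 1 x * (R * g) := by
      refine hasSum_le (fun y => ?_) (hasSum_occ_add M {0}ᶜ zero_le_one ht x)
        (((hasSum_occ M 1 x).mul_right (ε⁻¹ * g)).add (hIoi.mul_right (R * g)))
      rw [mul_assoc, ← mul_add]
      refine mul_le_mul_of_nonneg_left ?_ (occ_nonneg ..)
      rw [occ_zero]
      have h1 : 0 ≤ ε⁻¹ * g := by positivity
      rcases Nat.eq_zero_or_pos y with rfl | hy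
      · rw [occ_at_zero]
        simpa using h1
      by_cases hym : y ∈ Ioi m
      · rw [indicator_of_mem hym, Pi.one_apply, one_mul]
        linarith [ih y]
      · rw [indicator_of_notMem hym, zero_mul, add_zero]
        exact hlow y ⟨hy, not_lt.1 hym⟩
    have hstay : g ≤ Real.exp (b + d) * occ M {0}ᶜ (1 + t) 1 := by
      have h1 := occ_mul_le M {0}ᶜ zero_le_one ht 1 1
      have h2 := exp_le_occ_self hb hd hc hQ zero_le_one 1
      have h3 : Real.exp (-(b + d)) ≤ occ M {1} 1 1 := by simpa using h2
      have h4 := mul_le_mul_of_nonneg_right h3 hg0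
      rw [Real.exp_neg, inv_mul_eq_div, div_le_iff₀ (Real.exp_pos _)] at h4
      have h5 := mul_le_mul_of_nonneg_left h1 (Real.exp_pos (b + d)).le
      linarith
    have h1 := mul_le_mul_of_nonneg_right (hm' x) (show 0 ≤ R * g by positivity)
    have h2 : Real.exp (-(b + d)) * R = 2 * ε⁻¹ + 1 := by
      rw [hR, mul_comm, mul_assoc, ← Real.exp_add, add_neg_cancel, Real.exp_zero, mul_one]
    have h3 : occ M {0}ᶜ (1 + t) x ≤ (2 * ε⁻¹ + 1) * g := by
      have : Real.exp (-(b + d)) / 2 * (R * g) = (2 * ε⁻¹ + 1) / 2 * g := by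
        rw [← h2]
        ring
      linarith
    have h4 := mul_le_mul_of_nonneg_left hstay (show 0 ≤ 2 * ε⁻¹ + 1 by positivity)
    rw [← mul_assoc] at h4
    exact h3.trans h4
  have hall : ∀ n : ℕ, ∀ t : ℝ, 0 ≤ t → t ≤ (n : ℝ) + 1 → ∀ x, occ M {0}ᶜ t x ≤ R * occ M {0}ᶜ t 1 := by
    intro n
    induction n with
    | zero => simpa using hshort
    | succ n ih =>
      intro t ht htn
      rcases le_total t 1 with h1 | h1
      · exact hshort t ht h1
      · have h := hstep (t - 1) (by linarith) (ih (t - 1) (by linarith) (by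
          push_cast at htn
          linarith))
        rwa [add_sub_cancel] at h
  refine ⟨R, hRpos, fun t ht => ?_⟩
  obtain ⟨n, hn⟩ := exists_nat_gt t
  exact hall n t ht (by linarith)

/-- The conditioned process charges the state `1` after a unit of time, uniformly in the starting
point and in the conditioning horizon. -/
structure Minorized (M : AbsorbedProcess Ω) (κ : ℝ) : Prop where
  pos : 0 < κ
  lt_one : κ < 1
  survival_pos : ∀ t : ℝ, 0 ≤ t → ∀ x, x ≠ 0 → 0 < occ M {0}ᶜ t x
  le : ∀ t : ℝ, 0 ≤ t → ∀ x, x ≠ 0 →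
    κ * occ M {0}ᶜ (1 + t) x ≤ occ M {1} 1 x * occ M {0}ᶜ t 1

lemma exists_minorized (hb : 0 < b) (hd : 0 < d) (hc : 0 < c)
    (hQ : IsRateMatrixOf M (Qlog b d c)) : ∃ κ, Minorized M κ := by
  obtain ⟨R, hR, hR'⟩ := exists_survival_le hb hd hc hQ
  obtain ⟨c1, hc1, hc1'⟩ := exists_le_occ_one hb hd hc hQ
  refine ⟨min (c1 / R) (1 / 2), by positivity, (min_le_right _ _).trans_lt (by norm_num),
    fun t ht x hx => (occ_self_pos hb hd hc hQ ht x).trans_le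
      (occ_mono M (by simpa using hx.symm) _ _), fun t ht x hx => ?_⟩
  have hg := occ_nonneg M {0}ᶜ t 1
  calc min (c1 / R) (1 / 2) * occ M {0}ᶜ (1 + t) x ≤ c1 / R * (R * occ M {0}ᶜ t 1) :=
        mul_le_mul (min_le_left _ _) ((occ_survival_antitone M ht (by linarith) x).trans
          (hR' t ht x)) (occ_nonneg ..) (by positivity)
    _ = c1 * occ M {0}ᶜ t 1 := by field_simp
    _ ≤ occ M {1} 1 x * occ M {0}ᶜ t 1 := mul_le_mul_of_nonneg_right (hc1' x hx) hg

lemma mul_le_of_nonneg_combination (M : AbsorbedProcess Ω) {E : Set ℕ} (hE : 0 ∉ E)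
    {s t : ℝ} (hs : 0 ≤ s) (ht : 0 ≤ t) {p q : ℝ}
    (h : ∀ y, y ≠ 0 → 0 ≤ p * occ M {0}ᶜ t y + q * occ M E t y) (x z : ℕ) :
    occ M {z} s x * (p * occ M {0}ᶜ t z + q * occ M E t z)
      ≤ p * occ M {0}ᶜ (s + t) x + q * occ M E (s + t) x := by
  have h1 := ((hasSum_occ_add M {0}ᶜ hs ht x).mul_left p).add
    ((hasSum_occ_add M E hs ht x).mul_left q)
  have h2 : HasSum (fun y => occ M {y} s x * (p * occ M {0}ᶜ t y + q * occ M E t y))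
      (p * occ M {0}ᶜ (s + t) x + q * occ M E (s + t) x) := by
    refine h1.congr_fun fun y => ?_
    ring
  refine le_hasSum h2 z fun y _ => mul_nonneg (occ_nonneg ..) ?_
  by_cases hy : y = 0
  · subst hy
    simp [occ_at_zero, hE]
  · exact h y hy

lemma bounds_add {E : Set ℕ} (hE : 0 ∉ E) {α β t : ℝ} (ht : 0 ≤ t)
    (h : ∀ x, x ≠ 0 → α * occ M {0}ᶜ t x ≤ occ M E t x ∧ occ M E t x ≤ β * occ M {0}ᶜ t x)
    {s : ℝ} (hs : 0 ≤ s) (x : ℕ) :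
    α * occ M {0}ᶜ (s + t) x ≤ occ M E (s + t) x ∧
      occ M E (s + t) x ≤ β * occ M {0}ᶜ (s + t) x := by
  have h1 := mul_le_of_nonneg_combination M hE hs ht (p := -α) (q := 1)
    (fun y hy => by linarith [(h y hy).1]) x 0
  have h2 := mul_le_of_nonneg_combination M hE hs ht (p := β) (q := -1)
    (fun y hy => by linarith [(h y hy).2]) x 0
  simp only [occ_at_zero M E, occ_at_zero M {0}ᶜ, indicator_of_notMem hE, mem_compl_iff,
    mem_singleton_iff, not_true_eq_false, not_false_eq_true, indicator_of_notMem, mul_zero,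
    add_zero] at h1 h2
  constructor <;> linarith

variable {κ : ℝ}

lemma Minorized.exists_bounds (hM : Minorized M κ) {E : Set ℕ} (hE : 0 ∉ E) (n : ℕ) :
    ∀ t : ℝ, n ≤ t → ∃ α β : ℝ, β - α ≤ (1 - κ) ^ n ∧
      ∀ x, x ≠ 0 → α * occ M {0}ᶜ t x ≤ occ M E t x ∧ occ M E t x ≤ β * occ M {0}ᶜ t x := by
  induction n with
  | zero =>
    refine fun t _ => ⟨0, 1, by simp, fun x _ => ⟨?_, ?_⟩⟩
    · rw [zero_mul]
      exact occ_nonneg ..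
    · rw [one_mul]
      refine occ_mono M (fun y hy => ?_) _ _
      rintro rfl
      exact hE hy
  | succ n ih =>
    intro t ht
    push_cast at ht
    obtain ⟨s, rfl⟩ : ∃ s, t = 1 + s := ⟨t - 1, by ring⟩
    have hn : (0 : ℝ) ≤ n := n.cast_nonneg
    have hs : 0 ≤ s := by linarith
    obtain ⟨α, β, hαβ, h⟩ := ih s (by linarith)
    have hg := hM.survival_pos s hs 1 one_ne_zero
    set a := occ M E s 1 / occ M {0}ᶜ s 1 with ha
    have ha' : occ M E s 1 = a * occ M {0}ᶜ s 1 := (div_mul_cancel₀ _ hg.ne').symm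
    have hαa : α ≤ a := (le_div_iff₀ hg).2 (h 1 one_ne_zero).1
    have haβ : a ≤ β := (div_le_iff₀ hg).2 (h 1 one_ne_zero).2
    refine ⟨α + κ * (a - α), β - κ * (β - a), ?_, fun x hx => ⟨?_, ?_⟩⟩
    · rw [pow_succ]
      have := mul_le_mul_of_nonneg_right hαβ (show 0 ≤ 1 - κ by linarith [hM.lt_one])
      linarith
    · have h1 := mul_le_of_nonneg_combination M hE zero_le_one hs (p := -α) (q := 1)
        (fun y hy => by linarith [(h y hy).1]) x 1
      have h2 := mul_le_mul_of_nonneg_right (hM.le s hs x hx) (sub_nonneg.2 hαa)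
      rw [ha'] at h1
      linarith
    · have h1 := mul_le_of_nonneg_combination M hE zero_le_one hs (p := β) (q := -1)
        (fun y hy => by linarith [(h y hy).2]) x 1
      have h2 := mul_le_mul_of_nonneg_right (hM.le s hs x hx) (sub_nonneg.2 haβ)
      rw [ha'] at h1
      linarith

/-- `ℙ_x(X_t = y | t < T_0)` for `y ≠ 0`, and `0` for `y = 0`. -/
def condOcc (M : AbsorbedProcess Ω) (t : ℝ) (x y : ℕ) : ℝ :=
  occ M ({y} \ {0}) t x / occ M {0}ᶜ t x

lemma sum_condOcc (M : AbsorbedProcess Ω) (t : ℝ) (x : ℕ) (F : Finset ℕ) :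
    ∑ y ∈ F, condOcc M t x y = occ M ((F : Set ℕ) \ {0}) t x / occ M {0}ᶜ t x := by
  simp only [condOcc]
  rw [← Finset.sum_div]
  congr 1
  induction F using Finset.induction_on with
  | empty => simp [occ]
  | insert a s ha ih =>
    rw [Finset.sum_insert ha, ih, Finset.coe_insert, insert_eq, union_sdiff_distrib, occ_union]
    exact (disjoint_singleton_left.2 (by simpa using ha)).mono sdiff_subset sdiff_subset

lemma sum_abs_le_two_mul {f : ℕ → ℝ} {r : ℝ} (h : ∀ F : Finset ℕ, |∑ y ∈ F, f y| ≤ r)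
    (F : Finset ℕ) : ∑ y ∈ F, |f y| ≤ 2 * r := by
  rw [← Finset.sum_filter_add_sum_filter_not F (fun y => 0 ≤ f y)]
  have h1 : ∑ y ∈ F with 0 ≤ f y, |f y| = ∑ y ∈ F with 0 ≤ f y, f y :=
    Finset.sum_congr rfl fun y hy => abs_of_nonneg (Finset.mem_filter.1 hy).2
  have h2 : ∑ y ∈ F with ¬ 0 ≤ f y, |f y| = -∑ y ∈ F with ¬ 0 ≤ f y, f y := by
    rw [← Finset.sum_neg_distrib]
    exact Finset.sum_congr rfl fun y hy => abs_of_neg (not_le.1 (Finset.mem_filter.1 hy).2)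
  rw [h1, h2]
  have h3 := (abs_le.1 (h {y ∈ F | 0 ≤ f y})).2
  have h4 := (abs_le.1 (h {y ∈ F | ¬ 0 ≤ f y})).1
  linarith

lemma Minorized.sum_abs_condOcc_sub_le (hM : Minorized M κ) {s t : ℝ} (hs : 0 ≤ s) (ht : 0 ≤ t)
    {x x' : ℕ} (hx : x ≠ 0) (hx' : x' ≠ 0) (F : Finset ℕ) :
    ∑ y ∈ F, |condOcc M t x y - condOcc M (s + t) x' y| ≤ 2 * (1 - κ) ^ ⌊t⌋₊ := by
  refine sum_abs_le_two_mul (fun G => ?_) F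
  rw [Finset.sum_sub_distrib, sum_condOcc, sum_condOcc]
  have hG : 0 ∉ (G : Set ℕ) \ {0} := by simp
  obtain ⟨α, β, hαβ, h⟩ := hM.exists_bounds hG ⌊t⌋₊ t (Nat.floor_le ht)
  have h1 := h x hx
  have h2 := bounds_add hG ht h hs x'
  have g1 := hM.survival_pos t ht x hx
  have g2 := hM.survival_pos (s + t) (add_nonneg hs ht) x' hx'
  have l1 := (le_div_iff₀ g1).2 h1.1
  have l2 := (div_le_iff₀ g1).2 h1.2
  have l3 := (le_div_iff₀ g2).2 h2.1
  have l4 := (div_le_iff₀ g2).2 h2.2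
  rw [abs_le]
  constructor <;> linarith

end Contraction

/-! ### The limiting conditional law -/

section LimitLaw

variable {M : AbsorbedProcess Ω} {κ : ℝ}

/-- A probability vector on `ℕ*`. -/
structure IsWeight (w : ℕ → ℝ) : Prop where
  nonneg : ∀ x, 0 ≤ w x
  zero : w 0 = 0
  hasSum : HasSum w 1

lemma condOcc_nonneg (M : AbsorbedProcess Ω) (t : ℝ) (x y : ℕ) : 0 ≤ condOcc M t x y :=
  div_nonneg (occ_nonneg ..) (occ_nonneg ..)

lemma condOcc_zero (M : AbsorbedProcess Ω) (t : ℝ) (x : ℕ) : condOcc M t x 0 = 0 := by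
  simp [condOcc, occ]

lemma hasSum_condOcc_mul (M : AbsorbedProcess Ω) {E : Set ℕ} (hE : 0 ∉ E) {s t : ℝ} (hs : 0 ≤ s)
    (ht : 0 ≤ t) (x : ℕ) : HasSum (fun y => condOcc M s x y * occ M E t y)
      (occ M E (s + t) x / occ M {0}ᶜ s x) := by
  refine ((hasSum_occ_add M E hs ht x).div_const _).congr_fun fun y => ?_
  rcases eq_or_ne y 0 with rfl | hy
  · simp [occ_at_zero, hE]
  · rw [condOcc, sdiff_singleton_eq_self (by simpa using hy.symm)]
    ring

lemma hasSum_condOcc (M : AbsorbedProcess Ω) {t : ℝ} (ht : 0 ≤ t) {x : ℕ}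
    (h : 0 < occ M {0}ᶜ t x) : HasSum (condOcc M t x) 1 := by
  have h1 := hasSum_condOcc_mul M (E := {0}ᶜ) (by simp) ht le_rfl x
  rw [add_zero, div_self h.ne'] at h1
  refine h1.congr_fun fun y => ?_
  rcases eq_or_ne y 0 with rfl | hy
  · simp [condOcc_zero]
  · simp [occ_zero, hy]

lemma Minorized.tendsto_pow (hM : Minorized M κ) :
    Tendsto (fun n : ℕ => 2 * (1 - κ) ^ n) atTop (nhds 0) := by
  simpa using (tendsto_pow_atTop_nhds_zero_of_lt_one (r := 1 - κ) (by linarith [hM.lt_one])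
    (by linarith [hM.pos])).const_mul 2

lemma abs_tsum_le_tsum_abs {f : ℕ → ℝ} (hf : Summable fun x => |f x|) :
    |∑' x, f x| ≤ ∑' x, |f x| := by
  simp only [← Real.norm_eq_abs] at hf ⊢
  exact norm_tsum_le_tsum_norm hf

lemma abs_tsum_mul_sub_le {u v h : ℕ → ℝ} {r : ℝ} (hu : Summable u) (hv : Summable v)
    (hu' : ∀ x, 0 ≤ u x) (hv' : ∀ x, 0 ≤ v x) (h0 : ∀ x, 0 ≤ h x) (h1 : ∀ x, h x ≤ 1)
    (hr : ∀ F : Finset ℕ, ∑ x ∈ F, |u x - v x| ≤ r) :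
    |∑' x, u x * h x - ∑' x, v x * h x| ≤ r := by
  have hs : ∀ {f : ℕ → ℝ}, Summable f → (∀ x, 0 ≤ f x) → Summable fun x => f x * h x :=
    fun hf hf' => hf.of_nonneg_of_le (fun x => mul_nonneg (hf' x) (h0 x))
      fun x => mul_le_of_le_one_right (hf' x) (h1 x)
  have hd : Summable fun x => |u x - v x| :=
    summable_of_sum_le (fun x => abs_nonneg _) hr
  have hd' : Summable fun x => |(u x - v x) * h x| :=
    hd.of_nonneg_of_le (fun x => abs_nonneg _) fun x => by
      rw [abs_mul, abs_of_nonneg (h0 x)]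
      exact mul_le_of_le_one_right (abs_nonneg _) (h1 x)
  rw [← (hs hu hu').tsum_sub (hs hv hv')]
  calc |∑' x, (u x * h x - v x * h x)| = |∑' x, (u x - v x) * h x| := by simp only [sub_mul]
    _ ≤ ∑' x, |(u x - v x) * h x| := abs_tsum_le_tsum_abs hd'
    _ ≤ ∑' x, |u x - v x| := hd'.tsum_le_tsum (fun x => by
      rw [abs_mul, abs_of_nonneg (h0 x)]
      exact mul_le_of_le_one_right (abs_nonneg _) (h1 x)) hd
    _ ≤ r := hd.tsum_le_of_sum_le hr

/-- The conditional laws converge in total variation, uniformly in the starting point. -/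
lemma Minorized.exists_limit (hM : Minorized M κ) : ∃ ρ : ℕ → ℝ, IsWeight ρ ∧
    ∀ t : ℝ, 0 ≤ t → ∀ x, x ≠ 0 → ∀ F : Finset ℕ,
      ∑ y ∈ F, |condOcc M t x y - ρ y| ≤ 2 * (1 - κ) ^ ⌊t⌋₊ := by
  have hlim : ∀ y, ∃ l, Tendsto (fun n : ℕ => condOcc M n 1 y) atTop (nhds l) := by
    refine fun y => cauchySeq_tendsto_of_complete
      (cauchySeq_of_le_tendsto_0' (fun n => 2 * (1 - κ) ^ n) (fun n m hnm => ?_) hM.tendsto_pow)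
    have hnm' : (n : ℝ) ≤ m := by exact_mod_cast hnm
    have h := hM.sum_abs_condOcc_sub_le (sub_nonneg.2 hnm') n.cast_nonneg one_ne_zero one_ne_zero
      {y}
    rwa [Finset.sum_singleton, sub_add_cancel, Nat.floor_natCast] at h
  choose ρ hρ using hlim
  have hbound : ∀ t : ℝ, 0 ≤ t → ∀ x, x ≠ 0 → ∀ F : Finset ℕ,
      ∑ y ∈ F, |condOcc M t x y - ρ y| ≤ 2 * (1 - κ) ^ ⌊t⌋₊ := by
    intro t ht x hx F
    refine le_of_tendsto (tendsto_finsetSum F fun y _ => ((hρ y).const_sub _).abs) ?_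
    obtain ⟨N, hN⟩ := exists_nat_ge t
    filter_upwards [eventually_ge_atTop N] with n hn
    have hn' : (N : ℝ) ≤ n := by exact_mod_cast hn
    have h := hM.sum_abs_condOcc_sub_le (show (0 : ℝ) ≤ n - t by linarith) ht hx one_ne_zero F
    rwa [sub_add_cancel] at h
  have hρ0 : ∀ y, 0 ≤ ρ y := fun y =>
    ge_of_tendsto' (hρ y) fun n => condOcc_nonneg ..
  have hS : ∀ n : ℕ, HasSum (condOcc M n 1) 1 := fun n =>
    hasSum_condOcc M n.cast_nonneg (hM.survival_pos n n.cast_nonneg 1 one_ne_zero)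
  have hsum : Summable ρ := summable_of_sum_le hρ0 fun F =>
    le_of_tendsto' (tendsto_finsetSum F fun y _ => hρ y) fun n =>
      sum_le_hasSum F (fun y _ => condOcc_nonneg ..) (hS n)
  have htsum : ∑' y, ρ y = 1 := by
    have h : ∀ n : ℕ, |1 - ∑' y, ρ y| ≤ 2 * (1 - κ) ^ n := by
      intro n
      have h1 := abs_tsum_mul_sub_le (h := fun _ => 1) (hS n).summable hsum
        (fun y => condOcc_nonneg ..) hρ0 (fun _ => zero_le_one) (fun _ => le_rfl)
        (hbound n n.cast_nonneg 1 one_ne_zero)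
      simpa [(hS n).tsum_eq] using h1
    have h0 := ge_of_tendsto' hM.tendsto_pow h
    linarith [abs_eq_zero.1 (le_antisymm h0 (abs_nonneg _))]
  exact ⟨ρ, ⟨hρ0, tendsto_nhds_unique (hρ 0) (by simp [condOcc_zero]), htsum ▸ hsum.hasSum⟩,
    hbound⟩

/-- The conditional law at time `t` of the process started from the weights `w`. -/
def condAvg (M : AbsorbedProcess Ω) (w : ℕ → ℝ) (t : ℝ) (y : ℕ) : ℝ :=
  (∑' x, w x * occ M ({y} \ {0}) t x) / ∑' x, w x * occ M {0}ᶜ t x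

lemma IsWeight.summable_mul_occ {w : ℕ → ℝ} (hw : IsWeight w) (M : AbsorbedProcess Ω) (E : Set ℕ)
    (t : ℝ) : Summable fun x => w x * occ M E t x :=
  hw.hasSum.summable.of_nonneg_of_le (fun x => mul_nonneg (hw.nonneg x) (occ_nonneg ..))
    fun x => mul_le_of_le_one_right (hw.nonneg x) (occ_le_one ..)

lemma Minorized.survival_avg_pos (hM : Minorized M κ) {w : ℕ → ℝ} (hw : IsWeight w) {t : ℝ}
    (ht : 0 ≤ t) : 0 < ∑' x, w x * occ M {0}ᶜ t x := by
  obtain ⟨x, hx⟩ : ∃ x, w x ≠ 0 := by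
    by_contra! h
    have h1 := hw.hasSum
    rw [funext h] at h1
    exact zero_ne_one (hasSum_zero.unique h1)
  have hx0 : x ≠ 0 := by
    rintro rfl
    exact hx hw.zero
  exact (hw.summable_mul_occ M _ t).tsum_pos (fun y => mul_nonneg (hw.nonneg y) (occ_nonneg ..)) x
    (mul_pos ((hw.nonneg x).lt_of_ne' hx) (hM.survival_pos t ht x hx0))

lemma Minorized.sum_abs_condAvg_sub_le (hM : Minorized M κ) {w : ℕ → ℝ} (hw : IsWeight w) {t : ℝ}
    (ht : 0 ≤ t) {ρ : ℕ → ℝ} {r : ℝ} {F : Finset ℕ}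
    (h : ∀ x, x ≠ 0 → ∑ y ∈ F, |condOcc M t x y - ρ y| ≤ r) :
    ∑ y ∈ F, |condAvg M w t y - ρ y| ≤ r := by
  have hD := hM.survival_avg_pos hw ht
  set D := ∑' x, w x * occ M {0}ᶜ t x with hDdef
  have hsD := hw.summable_mul_occ M {0}ᶜ t
  set g : ℕ → ℕ → ℝ := fun y x =>
    w x * occ M ({y} \ {0}) t x - w x * occ M {0}ᶜ t x * ρ y with hg
  have hgs : ∀ y, Summable (g y) := fun y =>
    (hw.summable_mul_occ M _ t).sub (hsD.mul_right _)
  have hgt : ∀ y, condAvg M w t y - ρ y = (∑' x, g y x) / D := by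
    intro y
    rw [hg, (hw.summable_mul_occ M _ t).tsum_sub (hsD.mul_right _), tsum_mul_right, condAvg,
      sub_div, mul_div_cancel_left₀ _ hD.ne']
  have hpt : ∀ x, ∑ y ∈ F, |g y x| ≤ w x * occ M {0}ᶜ t x * r := by
    intro x
    rcases eq_or_ne x 0 with rfl | hx
    · simp [hg, hw.zero]
    have hpos := hM.survival_pos t ht x hx
    calc ∑ y ∈ F, |g y x| = ∑ y ∈ F, w x * occ M {0}ᶜ t x * |condOcc M t x y - ρ y| := by
          refine Finset.sum_congr rfl fun y _ => ?_
          rw [← abs_of_nonneg (mul_nonneg (hw.nonneg x) hpos.le), ← abs_mul, condOcc]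
          congr 1
          simp only [hg]
          field_simp
      _ ≤ w x * occ M {0}ᶜ t x * r := by
          rw [← Finset.mul_sum]
          exact mul_le_mul_of_nonneg_left (h x hx) (mul_nonneg (hw.nonneg x) hpos.le)
  calc ∑ y ∈ F, |condAvg M w t y - ρ y| ≤ ∑ y ∈ F, (∑' x, |g y x|) / D := by
        refine Finset.sum_le_sum fun y _ => ?_
        rw [hgt, abs_div, abs_of_pos hD]
        refine div_le_div_of_nonneg_right ?_ hD.le
        exact abs_tsum_le_tsum_abs (hgs y).abs
    _ = (∑' x, ∑ y ∈ F, |g y x|) / D := by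
        rw [← Finset.sum_div, Summable.tsum_finsetSum fun y _ => (hgs y).abs]
    _ ≤ (∑' x, w x * occ M {0}ᶜ t x * r) / D :=
        div_le_div_of_nonneg_right (Summable.tsum_le_tsum hpt
          (summable_sum fun y _ => (hgs y).abs) (hsD.mul_right r)) hD.le
    _ = r := by rw [tsum_mul_right, mul_div_cancel_left₀ _ hD.ne']

/-- The limiting conditional law is invariant under conditional evolution. -/
lemma Minorized.condAvg_limit (hM : Minorized M κ) {ρ : ℕ → ℝ} (hw : IsWeight ρ)
    (hρ : ∀ t : ℝ, 0 ≤ t → ∀ x, x ≠ 0 → ∀ F : Finset ℕ,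
      ∑ y ∈ F, |condOcc M t x y - ρ y| ≤ 2 * (1 - κ) ^ ⌊t⌋₊) {t : ℝ} (ht : 0 ≤ t) (y : ℕ) :
    condAvg M ρ t y = ρ y := by
  have hg : ∀ n : ℕ, 0 < occ M {0}ᶜ n 1 := fun n =>
    hM.survival_pos n n.cast_nonneg 1 one_ne_zero
  have hlim : ∀ E : Set ℕ, 0 ∉ E → Tendsto (fun n : ℕ => occ M E (n + t) 1 / occ M {0}ᶜ n 1) atTop
      (nhds (∑' x, ρ x * occ M E t x)) := by
    intro E hE
    refine tendsto_iff_dist_tendsto_zero.2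
      (squeeze_zero (fun _ => dist_nonneg) (fun n => ?_) hM.tendsto_pow)
    rw [Real.dist_eq, ← (hasSum_condOcc_mul M hE n.cast_nonneg ht 1).tsum_eq]
    have h := hρ n n.cast_nonneg 1 one_ne_zero
    rw [Nat.floor_natCast] at h
    exact abs_tsum_mul_sub_le (hasSum_condOcc M n.cast_nonneg (hg n)).summable
      hw.hasSum.summable (fun x => condOcc_nonneg ..) hw.nonneg (fun x => occ_nonneg ..)
      (fun x => occ_le_one ..) h
  have h1 : Tendsto (fun n : ℕ => condOcc M (n + t) 1 y) atTop (nhds (condAvg M ρ t y)) := by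
    refine ((hlim ({y} \ {0}) (by simp)).div (hlim {0}ᶜ (by simp))
      (hM.survival_avg_pos hw ht).ne').congr fun n => ?_
    exact div_div_div_cancel_right₀ (hg n).ne' _ _
  refine tendsto_nhds_unique h1 (tendsto_iff_dist_tendsto_zero.2
    (squeeze_zero (fun _ => dist_nonneg) (fun n => ?_) hM.tendsto_pow))
  have hn : (0 : ℝ) ≤ n := n.cast_nonneg
  have h := hρ (n + t) (by linarith) 1 one_ne_zero {y}
  rw [Finset.sum_singleton] at h
  rw [Real.dist_eq]
  refine h.trans (mul_le_mul_of_nonneg_left (pow_le_pow_of_le_one (by linarith [hM.lt_one])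
    (by linarith [hM.pos]) (Nat.le_floor (by linarith))) zero_le_two)

end LimitLaw

/-! ### Conditional distributions as measures -/

section Conditional

variable {M : AbsorbedProcess Ω} {κ : ℝ}

lemma isWeight_measureReal (μ : Measure ℕ) [IsProbabilityMeasure μ] (h0 : μ {0} = 0) :
    IsWeight fun x => μ.real {x} := by
  refine ⟨fun x => measureReal_nonneg, by simp [measureReal_def, h0], ?_⟩
  have h := hasSum_real_iUnion μ (f := fun x => {x}) (fun _ => MeasurableSet.of_discrete)
    fun x y hxy => disjoint_singleton.2 hxy
  rwa [iUnion_of_singleton, probReal_univ] at h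

lemma Pmu_ae (M : AbsorbedProcess Ω) (μ : Measure ℕ) {p : Ω → Prop}
    (h : ∀ x, ∀ᵐ ω ∂ M.P x, p ω) : ∀ᵐ ω ∂ Pmu M μ, p ω := by
  have hN : MeasurableSet (⋂ x, toMeasurable (M.P x) {ω | ¬ p ω}) :=
    MeasurableSet.iInter fun x => measurableSet_toMeasurable _ _
  rw [ae_iff]
  refine measure_mono_null (subset_iInter fun x => subset_toMeasurable (M.P x) _) ?_
  rw [Pmu, Measure.bind_apply hN (measurable_of_countable _).aemeasurable]
  refine lintegral_eq_zero_of_ae_eq_zero (Eventually.of_forall fun x => ?_)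
  refine measure_mono_null (iInter_subset _ x) ?_
  rw [measure_toMeasurable]
  exact h x

lemma Pmu_preimage (M : AbsorbedProcess Ω) {μ : Measure ℕ} [IsProbabilityMeasure μ]
    (h0 : μ {0} = 0) (E : Set ℕ) (t : ℝ≥0) :
    Pmu M μ (M.X t ⁻¹' E) = ENNReal.ofReal (∑' x, μ.real {x} * occ M E t x) := by
  have hw := isWeight_measureReal μ h0
  rw [Pmu, Measure.bind_apply (measurableSet_occ M E t) (measurable_of_countable _).aemeasurable,
    lintegral_countable', ENNReal.ofReal_tsum_of_nonneg
      (fun x => mul_nonneg (hw.nonneg x) (occ_nonneg ..)) (hw.summable_mul_occ M E t)]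
  refine tsum_congr fun x => ?_
  rw [ENNReal.ofReal_mul (hw.nonneg x), ofReal_measureReal, ofReal_occ, Real.toNNReal_coe,
    mul_comm]

lemma Minorized.condDist_singleton (hM : Minorized M κ) {μ : Measure ℕ} [IsProbabilityMeasure μ]
    (h0 : μ {0} = 0) (t : ℝ≥0) (y : ℕ) :
    condDist M μ t {y} = ENNReal.ofReal (condAvg M (fun x => μ.real {x}) t y) := by
  have hD := hM.survival_avg_pos (isWeight_measureReal μ h0) t.coe_nonneg
  have halive : alive M t =ᵐ[Pmu M μ] M.X t ⁻¹' {0}ᶜ :=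
    Pmu_ae M μ fun x => alive_ae_eq M t x
  rw [condDist, measure_congr halive, Measure.restrict_congr_set halive, Measure.smul_apply,
    Measure.map_apply (M.meas t) MeasurableSet.of_discrete,
    Measure.restrict_apply (measurableSet_occ M _ t), ← preimage_inter, Pmu_preimage M h0,
    Pmu_preimage M h0, smul_eq_mul, ← ENNReal.ofReal_inv_of_pos hD,
    ← ENNReal.ofReal_mul (inv_nonneg.2 hD.le), inv_mul_eq_div, ← sdiff_eq, condAvg]

lemma Minorized.pow_floor_le (hM : Minorized M κ) (t : ℝ) :
    2 * (1 - κ) ^ ⌊t⌋₊ ≤ 2 / (1 - κ) * Real.exp (-(-Real.log (1 - κ)) * t) := by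
  have h0 : 0 < 1 - κ := by linarith [hM.lt_one]
  have h1 : (1 - κ) ^ ⌊t⌋₊ = Real.exp (Real.log (1 - κ) * ⌊t⌋₊) := by
    rw [mul_comm, Real.exp_nat_mul, Real.exp_log h0]
  have h2 : Real.log (1 - κ) ≤ 0 := Real.log_nonpos h0.le (by linarith [hM.pos])
  have h3 : Real.exp (Real.log (1 - κ) * ⌊t⌋₊)
      ≤ Real.exp (-Real.log (1 - κ) + Real.log (1 - κ) * t) := by
    refine Real.exp_le_exp.2 ?_
    nlinarith [Nat.lt_floor_add_one t]
  rw [Real.exp_add, Real.exp_neg, Real.exp_log h0] at h3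
  rw [h1, neg_neg, div_eq_mul_inv, mul_assoc]
  exact mul_le_mul_of_nonneg_left h3 zero_le_two

/-- The conclusion about quasi-stationary distributions, from the minorization condition. -/
lemma Minorized.exists_qsd (hM : Minorized M κ) :
    ∃ ρ : Measure ℕ, IsProbabilityMeasure ρ ∧ ρ {0} = 0 ∧
      (∀ t : ℝ≥0, condDist M ρ t = ρ) ∧
      (∀ ρ' : Measure ℕ, IsProbabilityMeasure ρ' → ρ' {0} = 0 →
        (∀ t : ℝ≥0, condDist M ρ' t = ρ') → ρ' = ρ) ∧
      ∃ C γ : ℝ, 0 < C ∧ 0 < γ ∧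
        ∀ μ : Measure ℕ, IsProbabilityMeasure μ → μ {0} = 0 → ∀ t : ℝ≥0,
          tvDist (condDist M μ t) ρ ≤ C * Real.exp (-γ * t) := by
  obtain ⟨ρ, hw, hρ⟩ := hM.exists_limit
  set ν : Measure ℕ := Measure.sum fun x => ENNReal.ofReal (ρ x) • Measure.dirac x with hν
  have hνs : ∀ y, ν {y} = ENNReal.ofReal (ρ y) := by
    intro y
    rw [hν, Measure.sum_apply _ MeasurableSet.of_discrete, tsum_eq_single y]
    · simp
    · intro x hx
      simp [hx]
  have hνr : ∀ y, (ν {y}).toReal = ρ y := fun y => by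
    rw [hνs, ENNReal.toReal_ofReal (hw.nonneg y)]
  have hνp : IsProbabilityMeasure ν := by
    refine ⟨?_⟩
    rw [hν, Measure.sum_apply _ MeasurableSet.univ]
    simp [← ENNReal.ofReal_tsum_of_nonneg hw.nonneg hw.hasSum.summable, hw.hasSum.tsum_eq]
  have hν0 : ν {0} = 0 := by simp [hνs, hw.zero]
  have hcond : ∀ μ : Measure ℕ, IsProbabilityMeasure μ → μ {0} = 0 → ∀ (t : ℝ≥0) (F : Finset ℕ),
      ∑ y ∈ F, |(condDist M μ t {y}).toReal - (ν {y}).toReal| ≤ 2 * (1 - κ) ^ ⌊(t : ℝ)⌋₊ := by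
    intro μ _ h0 t F
    have hwμ := isWeight_measureReal μ h0
    refine le_trans (le_of_eq (Finset.sum_congr rfl fun y _ => ?_))
      (hM.sum_abs_condAvg_sub_le hwμ t.coe_nonneg fun x hx => hρ t t.coe_nonneg x hx F)
    rw [hM.condDist_singleton h0, ENNReal.toReal_ofReal, hνr]
    exact div_nonneg (tsum_nonneg fun x => mul_nonneg (hwμ.nonneg x) (occ_nonneg ..))
      (tsum_nonneg fun x => mul_nonneg (hwμ.nonneg x) (occ_nonneg ..))
  refine ⟨ν, hνp, hν0, fun t => ?_, fun ρ' hp h0 hq => ?_, 2 / (1 - κ), -Real.log (1 - κ),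
    div_pos two_pos (by linarith [hM.lt_one]),
    neg_pos.2 (Real.log_neg (by linarith [hM.lt_one]) (by linarith [hM.pos])),
    fun μ hp h0 t => ?_⟩
  · refine Measure.ext_of_singleton fun y => ?_
    rw [hM.condDist_singleton hν0, hνs]
    congr 1
    have hfun : (fun x => ν.real {x}) = ρ := funext hνr
    rw [hfun]
    exact hM.condAvg_limit hw hρ t.coe_nonneg y
  · refine Measure.ext_of_singleton fun y => ?_
    rw [← ENNReal.toReal_eq_toReal_iff' (measure_ne_top _ _) (measure_ne_top _ _), ← sub_eq_zero,
      ← abs_eq_zero]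
    refine le_antisymm (ge_of_tendsto' hM.tendsto_pow fun n => ?_) (abs_nonneg _)
    have h := hcond ρ' hp h0 n {y}
    rwa [hq, Finset.sum_singleton, NNReal.coe_natCast, Nat.floor_natCast] at h
  · exact (Real.tsum_le_of_sum_le (fun _ => abs_nonneg _) (hcond μ hp h0 t)).trans
      (hM.pow_floor_le t)

end Conditional

/-- the logistic birth and death process fulfills Hypothesis (H).
In particular it has a unique quasi-stationary distribution `ρ`, and there are
positive constants `C`, `γ` such that for every probability measure `μ` on `ℕ*`
and all `t ≥ 0`, `‖ℙ_μ(X_t ∈ · | t < T_0) − ρ‖_TV ≤ C e^{-γ t}`. -/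
theorem logistic_qsd (b d c : ℝ) (hb : 0 < b) (hd : 0 < d) (hc : 0 < c)
    (M : AbsorbedProcess Ω) (hQ : IsRateMatrixOf M (Qlog b d c)) :
    (∃ (K : Set ℕ) (x0 : ℕ) (c1 c2 c3 c4 l0 : ℝ), HypH M K x0 c1 c2 c3 c4 l0) ∧
    ∃ ρ : Measure ℕ, IsProbabilityMeasure ρ ∧ ρ {0} = 0 ∧
      (∀ t : ℝ≥0, condDist M ρ t = ρ) ∧
      (∀ ρ' : Measure ℕ, IsProbabilityMeasure ρ' → ρ' {0} = 0 →
        (∀ t : ℝ≥0, condDist M ρ' t = ρ') → ρ' = ρ) ∧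
      ∃ C γ : ℝ, 0 < C ∧ 0 < γ ∧
        ∀ μ : Measure ℕ, IsProbabilityMeasure μ → μ {0} = 0 → ∀ t : ℝ≥0,
          tvDist (condDist M μ t) ρ ≤ C * Real.exp (-γ * t) := by
  obtain ⟨κ, hM⟩ := exists_minorized hb hd hc hQ
  exact ⟨exists_hypH hb hd hc hQ, hM.exists_qsd⟩

end
end

section
/- Assume (i) P_1(x,{x_0}) ≥ c_1 · P_1(x,ℕ*) for all x ∈ ℕ* (a conditional one-step minorization at x_0), and (ii) there is γ_0 > 0 such that h_u(x_0) ≥ γ_0 · sup_{y∈ℕ*} h_u(y) for all u ≥ 0. Then for every T ≥ 1, every 0 ≤ s ≤ T − 1, every nonnegative bounded f : ℕ → ℝ and every x ∈ ℕ*, R_{s,s+1}^T f(x) ≥ c_1 γ_0 · f(x_0). -/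
open MeasureTheory ENNReal Set Filter
open scoped NNReal ENNReal

noncomputable section

/-- A time-homogeneous Markov transition semigroup on `ℕ`: each `P t` is a
probability kernel, `P 0 x` is the Dirac mass at `x`, the Chapman-Kolmogorov
equations hold, and the state `0` is absorbing. -/
structure TransSemigroup where
  P : ℝ≥0 → ℕ → Measure ℕ
  prob : ∀ t x, IsProbabilityMeasure (P t x)
  init : ∀ x, P 0 x = Measure.dirac x
  chapman : ∀ (s t : ℝ≥0) (x : ℕ) (A : Set ℕ),
    P (s + t) x A = ∑' y : ℕ, P s x {y} * P t y A
  absorb : ∀ t : ℝ≥0, P t 0 {0} = 1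

/-- The survival probability `h_t(x) = P_t(x, ℕ*) = ℙ_x(t < T_0)`. -/
def hS (S : TransSemigroup) (t : ℝ≥0) (x : ℕ) : ℝ≥0∞ := S.P t x {y : ℕ | y ≠ 0}

/-- The conditioned evolution operator
`R_{s,t}^T f(x) = (∑_y P_{t−s}(x,{y}) f(y) h_{T−t}(y)) / h_{T−s}(x)`. -/
def R (S : TransSemigroup) (s t T : ℝ≥0) (f : ℕ → ℝ) (x : ℕ) : ℝ :=
  (∑' y : ℕ, (S.P (t - s) x {y}).toReal * f y * (hS S (T - t) y).toReal)
    / (hS S (T - s) x).toReal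

/-- The absorbing state never survives. -/
lemma hS_zero (S : TransSemigroup) (t : ℝ≥0) : hS S t 0 = 0 := by
  have := S.prob t 0
  exact (prob_compl_eq_zero_iff (measurableSet_singleton 0)).2 (S.absorb t)

lemma hS_ne_top (S : TransSemigroup) (t : ℝ≥0) (x : ℕ) : hS S t x ≠ ∞ := by
  have := S.prob t x
  exact measure_ne_top _ _

/-- Chapman-Kolmogorov for survival probabilities. -/
lemma hS_add (S : TransSemigroup) (s t : ℝ≥0) (x : ℕ) :
    hS S (s + t) x = ∑' y : ℕ, S.P s x {y} * hS S t y :=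
  S.chapman s t x _

/-- If survival from any state over time `t` is controlled by `C`, then survival over
time `s + t` is controlled by `C` times survival over time `s`. -/
lemma mul_hS_add_le (S : TransSemigroup) (s t : ℝ≥0) (x : ℕ) {a C : ℝ≥0∞}
    (h : ∀ y : ℕ, y ≠ 0 → a * hS S t y ≤ C) :
    a * hS S (s + t) x ≤ hS S s x * C := by
  have hsum : hS S s x = ∑' y : ℕ, {y : ℕ | y ≠ 0}.indicator (fun y => S.P s x {y}) y :=
    (Measure.tsum_indicator_apply_singleton _ _ (MeasurableSet.of_discrete)).symm
  rw [hS_add, hsum, ← ENNReal.tsum_mul_left, ← ENNReal.tsum_mul_right]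
  refine ENNReal.tsum_le_tsum fun y => ?_
  by_cases hy : y = 0
  · simp [hy, hS_zero]
  · rw [indicator_of_mem (by exact hy), mul_left_comm]
    gcongr
    exact h y hy

lemma summable_R_terms (S : TransSemigroup) (s t : ℝ≥0) (x : ℕ) {f : ℕ → ℝ}
    (hf : ∀ y, 0 ≤ f y) {C : ℝ} (hC : ∀ y, f y ≤ C) :
    Summable fun y : ℕ => (S.P s x {y}).toReal * f y * (hS S t y).toReal := by
  have hsum : Summable fun y : ℕ => (S.P s x {y} * hS S t y).toReal :=
    ENNReal.summable_toReal (by rw [← hS_add]; exact hS_ne_top S _ x)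
  refine Summable.of_nonneg_of_le (fun y => ?_) (fun y => ?_) (hsum.mul_left C)
  · have := hf y
    positivity
  · rw [ENNReal.toReal_mul, mul_right_comm, mul_comm]
    gcongr
    exact hC y

/-- if `P_1(x,{x₀}) ≥ c₁ P_1(x,ℕ*)` for all `x ∈ ℕ*` and
`h_u(x₀) ≥ γ₀ sup_{y∈ℕ*} h_u(y)` for all `u ≥ 0`, then for every `T ≥ 1`,
`0 ≤ s ≤ T−1`, nonnegative bounded `f` and `x ∈ ℕ*`,
`R_{s,s+1}^T f(x) ≥ c₁ γ₀ f(x₀)`. -/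
theorem R_dobrushin_minorization (S : TransSemigroup)
    (hpos : ∀ (t : ℝ≥0) (x : ℕ), x ≠ 0 → 0 < hS S t x)
    (x0 : ℕ) (hx0 : x0 ≠ 0) (c1 γ0 : ℝ) (hc1 : 0 < c1) (hγ0 : 0 < γ0)
    (hmin : ∀ x : ℕ, x ≠ 0 → ENNReal.ofReal c1 * hS S 1 x ≤ S.P 1 x {x0})
    (hcomp : ∀ u : ℝ≥0, ∀ y : ℕ, y ≠ 0 → ENNReal.ofReal γ0 * hS S u y ≤ hS S u x0) :
    ∀ T : ℝ≥0, 1 ≤ T → ∀ s : ℝ≥0, s ≤ T - 1 →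
      ∀ f : ℕ → ℝ, (∀ y : ℕ, 0 ≤ f y) → (∃ Cf : ℝ, ∀ y : ℕ, f y ≤ Cf) →
      ∀ x : ℕ, x ≠ 0 → c1 * γ0 * f x0 ≤ R S s (s + 1) T f x := by
  intro T hT s hs f hf ⟨C, hC⟩ x hx
  have hsT : s + 1 ≤ T := (le_tsub_iff_right hT).1 hs
  obtain ⟨u, rfl⟩ := exists_add_of_le hsT
  have h1 : s + 1 + u - s = 1 + u := by rw [add_assoc, add_tsub_cancel_left]
  rw [R, add_tsub_cancel_left, add_tsub_cancel_left, h1,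
    le_div_iff₀ (ENNReal.toReal_pos (hpos _ x hx).ne' (hS_ne_top S _ x))]
  have hkey : ENNReal.ofReal c1 * (ENNReal.ofReal γ0 * hS S (1 + u) x)
      ≤ S.P 1 x {x0} * hS S u x0 :=
    calc ENNReal.ofReal c1 * (ENNReal.ofReal γ0 * hS S (1 + u) x)
        ≤ ENNReal.ofReal c1 * (hS S 1 x * hS S u x0) := by
          gcongr ENNReal.ofReal c1 * ?_
          exact mul_hS_add_le S 1 u x (hcomp u)
      _ = ENNReal.ofReal c1 * hS S 1 x * hS S u x0 := (mul_assoc _ _ _).symm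
      _ ≤ S.P 1 x {x0} * hS S u x0 := by
          gcongr
          exact hmin x hx
  have := S.prob 1 x
  have hreal := ENNReal.toReal_mono
    (ENNReal.mul_ne_top (measure_ne_top _ _) (hS_ne_top S u x0)) hkey
  simp only [ENNReal.toReal_mul, ENNReal.toReal_ofReal hc1.le,
    ENNReal.toReal_ofReal hγ0.le] at hreal
  calc c1 * γ0 * f x0 * (hS S (1 + u) x).toReal
      = f x0 * (c1 * (γ0 * (hS S (1 + u) x).toReal)) := by ring
    _ ≤ f x0 * ((S.P 1 x {x0}).toReal * (hS S u x0).toReal) :=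
        mul_le_mul_of_nonneg_left hreal (hf x0)
    _ = (S.P 1 x {x0}).toReal * f x0 * (hS S u x0).toReal := by ring
    _ ≤ _ := (summable_R_terms S 1 u x hf hC).le_tsum x0 fun y _ => by
        have := hf y
        positivity

end
end

section
/- Fix T ≥ 0 and ε ≥ 0, and assume that ‖Φ_T(δ_x) − Φ_T(δ_y)‖_TV ≤ ε for all x, y ∈ ℕ*. Then for all probability measures μ and ν on ℕ*, ‖Φ_T(μ) − Φ_T(ν)‖_TV ≤ ε. -/
open MeasureTheory ENNReal Set Filter
open scoped NNReal ENNReal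

noncomputable section

/-- The conditional distribution at time `t` started from `μ`:
`Φ_t(μ)(A) = (∑_x μ({x}) P_t(x, A ∩ ℕ*)) / (∑_x μ({x}) h_t(x))`. -/
def Phi (S : TransSemigroup) (t : ℝ≥0) (μ : Measure ℕ) : Measure ℕ :=
  ((μ.bind fun x => (S.P t x).restrict {y : ℕ | y ≠ 0}) Set.univ)⁻¹ •
    (μ.bind fun x => (S.P t x).restrict {y : ℕ | y ≠ 0})

/-- The total variation distance of two measures on `ℕ`, as an extended nonnegative real. -/
def etvDist (μ ν : Measure ℕ) : ℝ≥0∞ := ∑' z : ℕ, ((μ {z} - ν {z}) + (ν {z} - μ {z}))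

lemma etvDist_comm (μ ν : Measure ℕ) : etvDist μ ν = etvDist ν μ :=
  tsum_congr fun _ => add_comm _ _

lemma tsum_measure_singleton (μ : Measure ℕ) : ∑' z : ℕ, μ {z} = μ univ := by
  simpa using (lintegral_countable' (μ := μ) (fun _ : ℕ => (1 : ℝ≥0∞))).symm

lemma etvDist_ne_top (μ ν : Measure ℕ) [IsFiniteMeasure μ] [IsFiniteMeasure ν] :
    etvDist μ ν ≠ ∞ := by
  have h : etvDist μ ν ≤ μ univ + ν univ := by
    rw [← tsum_measure_singleton μ, ← tsum_measure_singleton ν, ← ENNReal.tsum_add]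
    exact ENNReal.tsum_le_tsum fun z => add_le_add tsub_le_self tsub_le_self
  exact ne_top_of_le_ne_top (by finiteness) h

lemma toReal_tsub_add_tsub {u v : ℝ≥0∞} (hu : u ≠ ∞) (hv : v ≠ ∞) :
    ((u - v) + (v - u)).toReal = |u.toReal - v.toReal| := by
  rcases le_total u v with h | h
  · rw [tsub_eq_zero_of_le h, zero_add, ENNReal.toReal_sub_of_le h hv, abs_sub_comm,
      abs_of_nonneg (sub_nonneg.2 (ENNReal.toReal_mono hv h))]
  · rw [tsub_eq_zero_of_le h, add_zero, ENNReal.toReal_sub_of_le h hu,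
      abs_of_nonneg (sub_nonneg.2 (ENNReal.toReal_mono hu h))]

lemma tvDist_eq_toReal_etvDist (μ ν : Measure ℕ) [IsFiniteMeasure μ] [IsFiniteMeasure ν] :
    tvDist μ ν = (etvDist μ ν).toReal := by
  unfold tvDist etvDist
  rw [ENNReal.tsum_toReal_eq fun z => by finiteness]
  exact tsum_congr fun z => (toReal_tsub_add_tsub (by finiteness) (by finiteness)).symm

lemma tvDist_le_iff_etvDist_le (μ ν : Measure ℕ) [IsFiniteMeasure μ] [IsFiniteMeasure ν]
    {ε : ℝ} (hε : 0 ≤ ε) : tvDist μ ν ≤ ε ↔ etvDist μ ν ≤ ENNReal.ofReal ε := by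
  rw [tvDist_eq_toReal_etvDist, ENNReal.le_ofReal_iff_toReal_le (etvDist_ne_top μ ν) hε]

lemma tsum_mul_tsub_le {a p : ℕ → ℝ≥0∞} {r : ℝ≥0∞} (ha : ∑' x, a x = 1) :
    (∑' x, a x * p x) - r ≤ ∑' x, a x * (p x - r) := by
  rw [tsub_le_iff_right]
  calc ∑' x, a x * p x ≤ ∑' x, (a x * (p x - r) + a x * r) :=
        ENNReal.tsum_le_tsum fun x => by rw [← mul_add]; gcongr; exact le_tsub_add
    _ = _ := by rw [ENNReal.tsum_add, ENNReal.tsum_mul_right, ha, one_mul]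

lemma tsub_tsum_mul_le {a p : ℕ → ℝ≥0∞} {r : ℝ≥0∞} (ha : ∑' x, a x = 1) :
    r - (∑' x, a x * p x) ≤ ∑' x, a x * (r - p x) := by
  rw [tsub_le_iff_right, ← ENNReal.tsum_add]
  calc r = ∑' x, a x * r := by rw [ENNReal.tsum_mul_right, ha, one_mul]
    _ ≤ _ := ENNReal.tsum_le_tsum fun x => by rw [← mul_add]; gcongr; exact le_tsub_add

/-- Balls for the total variation distance are stable under countable mixtures. -/
lemma etvDist_mixture_le {a : ℕ → ℝ≥0∞} (ha : ∑' x, a x = 1) {p : ℕ → Measure ℕ}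
    {m q : Measure ℕ} (hm : ∀ z, m {z} = ∑' x, a x * p x {z}) {e : ℝ≥0∞}
    (hp : ∀ x, a x ≠ 0 → etvDist (p x) q ≤ e) : etvDist m q ≤ e := by
  calc etvDist m q
      ≤ ∑' z, ∑' x, a x * ((p x {z} - q {z}) + (q {z} - p x {z})) := by
        refine ENNReal.tsum_le_tsum fun z => ?_
        simp_rw [hm z, mul_add, ENNReal.tsum_add]
        exact add_le_add (tsum_mul_tsub_le ha) (tsub_tsum_mul_le ha)
    _ = ∑' x, a x * etvDist (p x) q := by
        rw [ENNReal.tsum_comm]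
        exact tsum_congr fun x => ENNReal.tsum_mul_left
    _ ≤ ∑' x, a x * e := by
        refine ENNReal.tsum_le_tsum fun x => ?_
        by_cases hx : a x = 0
        · simp [hx]
        · gcongr
          exact hp x hx
    _ = e := by rw [ENNReal.tsum_mul_right, ha, one_mul]

lemma bind_restrict_apply (S : TransSemigroup) (t : ℝ≥0) (μ : Measure ℕ) (A : Set ℕ) :
    (μ.bind fun x => (S.P t x).restrict {y : ℕ | y ≠ 0}) A
      = ∑' x, μ {x} * (S.P t x).restrict {y : ℕ | y ≠ 0} A := by
  rw [Measure.bind_apply (by measurability) (measurable_of_countable _).aemeasurable,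
    lintegral_countable']
  exact tsum_congr fun x => mul_comm _ _

lemma hS_le_one (S : TransSemigroup) (t : ℝ≥0) (x : ℕ) : hS S t x ≤ 1 :=
  have := S.prob t x
  prob_le_one

lemma bind_restrict_univ (S : TransSemigroup) (t : ℝ≥0) (μ : Measure ℕ) :
    (μ.bind fun x => (S.P t x).restrict {y : ℕ | y ≠ 0}) univ = ∑' x, μ {x} * hS S t x := by
  simp [bind_restrict_apply, hS]

lemma Phi_apply (S : TransSemigroup) (t : ℝ≥0) (μ : Measure ℕ) (A : Set ℕ) :
    Phi S t μ A = (∑' x, μ {x} * hS S t x)⁻¹ *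
      ∑' x, μ {x} * (S.P t x).restrict {y : ℕ | y ≠ 0} A := by
  rw [Phi, bind_restrict_univ, Measure.smul_apply, bind_restrict_apply, smul_eq_mul]

lemma tsum_dirac_mul (f : ℕ → ℝ≥0∞) (x : ℕ) : ∑' y, Measure.dirac x {y} * f y = f x := by
  simpa [mul_comm] using (lintegral_countable' (μ := Measure.dirac x) f).symm

lemma Phi_dirac_apply (S : TransSemigroup) (t : ℝ≥0) (x : ℕ) (A : Set ℕ) :
    Phi S t (Measure.dirac x) A =
      (hS S t x)⁻¹ * (S.P t x).restrict {y : ℕ | y ≠ 0} A := by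
  rw [Phi_apply, tsum_dirac_mul, tsum_dirac_mul]

section

variable {S : TransSemigroup} {t : ℝ≥0} {μ : Measure ℕ}

lemma tsum_mul_hS_ne_top [IsProbabilityMeasure μ] : ∑' x, μ {x} * hS S t x ≠ ∞ := by
  refine ne_top_of_le_ne_top one_ne_top ?_
  calc ∑' x, μ {x} * hS S t x ≤ ∑' x, μ {x} :=
        ENNReal.tsum_le_tsum fun x => mul_le_of_le_one_right' (hS_le_one S t x)
    _ = 1 := by rw [tsum_measure_singleton, measure_univ]

lemma tsum_mul_hS_ne_zero (hpos : ∀ x : ℕ, x ≠ 0 → 0 < hS S t x)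
    [IsProbabilityMeasure μ] (h0 : μ {0} = 0) : ∑' x, μ {x} * hS S t x ≠ 0 := by
  intro h
  have hz : ∀ x, μ {x} = 0 := fun x => by
    by_cases hx : x = 0
    · rw [hx, h0]
    · exact (mul_eq_zero.1 (ENNReal.tsum_eq_zero.1 h x)).resolve_right (hpos x hx).ne'
  have h1 : ∑' x, μ {x} = 1 := by rw [tsum_measure_singleton, measure_univ]
  simp [hz] at h1

lemma isProbabilityMeasure_Phi (hpos : ∀ x : ℕ, x ≠ 0 → 0 < hS S t x)
    [IsProbabilityMeasure μ] (h0 : μ {0} = 0) : IsProbabilityMeasure (Phi S t μ) := by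
  refine ⟨?_⟩
  rw [Phi, Measure.smul_apply, smul_eq_mul, bind_restrict_univ]
  exact ENNReal.inv_mul_cancel (tsum_mul_hS_ne_zero hpos h0) tsum_mul_hS_ne_top

/-- `Φ_t(μ)` is the mixture of the `Φ_t(δ_x)` with weights proportional to `μ({x}) h_t(x)`. -/
lemma etvDist_Phi_le (hpos : ∀ x : ℕ, x ≠ 0 → 0 < hS S t x)
    [IsProbabilityMeasure μ] (h0 : μ {0} = 0) {q : Measure ℕ} {e : ℝ≥0∞}
    (h : ∀ x : ℕ, x ≠ 0 → etvDist (Phi S t (Measure.dirac x)) q ≤ e) :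
    etvDist (Phi S t μ) q ≤ e := by
  refine etvDist_mixture_le
    (a := fun x => (∑' y, μ {y} * hS S t y)⁻¹ * (μ {x} * hS S t x))
    (p := fun x => Phi S t (Measure.dirac x)) ?_ ?_ ?_
  · rw [ENNReal.tsum_mul_left]
    exact ENNReal.inv_mul_cancel (tsum_mul_hS_ne_zero hpos h0) tsum_mul_hS_ne_top
  · intro z
    rw [Phi_apply, ← ENNReal.tsum_mul_left]
    refine tsum_congr fun x => ?_
    by_cases hx : x = 0
    · simp [hx, h0]
    · rw [Phi_dirac_apply, mul_assoc, mul_assoc, ← mul_assoc (hS S t x),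
        ENNReal.mul_inv_cancel (hpos x hx).ne' (ne_top_of_le_ne_top one_ne_top (hS_le_one S t x)),
        one_mul]
  · intro x hx
    refine h x ?_
    rintro rfl
    simp [h0] at hx

end

/-- fix `T ≥ 0` and `ε ≥ 0`; if
`‖Φ_T(δ_x) − Φ_T(δ_y)‖_TV ≤ ε` for all `x, y ∈ ℕ*`, then
`‖Φ_T(μ) − Φ_T(ν)‖_TV ≤ ε` for all probability measures `μ`, `ν` on `ℕ*`. -/
theorem tv_contraction_extends_to_measures (S : TransSemigroup)
    (hpos : ∀ (t : ℝ≥0) (x : ℕ), x ≠ 0 → 0 < hS S t x)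
    (T : ℝ≥0) (ε : ℝ) (hε : 0 ≤ ε)
    (hxy : ∀ x : ℕ, x ≠ 0 → ∀ y : ℕ, y ≠ 0 →
      tvDist (Phi S T (Measure.dirac x)) (Phi S T (Measure.dirac y)) ≤ ε) :
    ∀ μ ν : Measure ℕ, IsProbabilityMeasure μ → IsProbabilityMeasure ν →
      μ {0} = 0 → ν {0} = 0 → tvDist (Phi S T μ) (Phi S T ν) ≤ ε := by
  intro μ ν _ _ hμ hν
  have hprob : ∀ (ρ : Measure ℕ) [IsProbabilityMeasure ρ], ρ {0} = 0 →
      IsProbabilityMeasure (Phi S T ρ) := fun _ _ h => isProbabilityMeasure_Phi (hpos T) h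
  have hdirac : ∀ x : ℕ, x ≠ 0 → IsProbabilityMeasure (Phi S T (Measure.dirac x)) :=
    fun x hx => hprob _ (by simp [hx])
  have := hprob μ hμ
  have := hprob ν hν
  rw [tvDist_le_iff_etvDist_le _ _ hε]
  refine etvDist_Phi_le (hpos T) hμ fun x hx => ?_
  rw [etvDist_comm]
  refine etvDist_Phi_le (hpos T) hν fun y hy => ?_
  have := hdirac x hx
  have := hdirac y hy
  exact (tvDist_le_iff_etvDist_le _ _ hε).1 (hxy y hy x hx)

end
end

section
/- Let X be the logistic birth and death process with parameters b, d, c > 0, and set λ_0 = b + d. Then there exists z_0 ∈ ℕ* such that, with K = {1, 2, …, z_0}, sup_{x∈ℕ*} 𝔼_x(e^{λ_0 T_K}) < ∞, where T_K = inf{t ≥ 0 : X_t ∈ K}. -/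
open MeasureTheory ENNReal Set Filter
open scoped NNReal ENNReal

noncomputable section

variable {Ω : Type*} [MeasurableSpace Ω]

namespace AbsorbedProcess

lemma ae_init (M : AbsorbedProcess Ω) (x : ℕ) : ∀ᵐ ω ∂ M.P x, M.X 0 ω = x := by
  have := M.prob x
  have hm : MeasurableSet {ω | M.X 0 ω = x} := M.meas 0 (measurableSet_singleton x)
  exact (prob_compl_eq_zero_iff hm).2 (M.init x)

/-- The law of the path under `ℙ_x`, evaluated at a set of paths. -/
def pathProb (M : AbsorbedProcess Ω) (x : ℕ) (B : Set (ℝ≥0 → ℕ)) : ℝ≥0∞ :=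
  M.P x {ω | (fun u => M.X u ω) ∈ B}

lemma pathProb_le_one (M : AbsorbedProcess Ω) (x : ℕ) (B : Set (ℝ≥0 → ℕ)) :
    M.pathProb x B ≤ 1 := by
  have := M.prob x
  exact prob_le_one

lemma measurable_path (M : AbsorbedProcess Ω) : Measurable fun ω u => M.X u ω :=
  measurable_pi_lambda _ M.meas

lemma pathProb_congr (M : AbsorbedProcess Ω) (x : ℕ) {A B : Set (ℝ≥0 → ℕ)}
    (h : ∀ w : ℝ≥0 → ℕ, w 0 = x → (w ∈ A ↔ w ∈ B)) : M.pathProb x A = M.pathProb x B := by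
  refine measure_congr ?_
  filter_upwards [M.ae_init x] with ω hω
  exact propext (h (fun u => M.X u ω) hω)

lemma pathProb_shift (M : AbsorbedProcess Ω) (x : ℕ) (h : ℝ≥0) {B : Set (ℝ≥0 → ℕ)}
    (hB : MeasurableSet B) :
    M.pathProb x {w | (fun u => w (h + u)) ∈ B}
      = ∑' y, M.P x {ω | M.X h ω = y} * M.pathProb y B := by
  have hs : Measurable fun (ω : Ω) (u : ℝ≥0) => M.X (h + u) ω :=
    measurable_pi_lambda _ fun u => M.meas (h + u)
  have hU : {ω | (fun u => M.X (h + u) ω) ∈ B}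
      = ⋃ y, ({ω | M.X h ω = y} ∩ {ω | (fun u => M.X (h + u) ω) ∈ B}) := by
    ext ω; simp
  calc M.pathProb x {w | (fun u => w (h + u)) ∈ B}
      = M.P x {ω | (fun u => M.X (h + u) ω) ∈ B} := rfl
    _ = ∑' y, M.P x ({ω | M.X h ω = y} ∩ {ω | (fun u => M.X (h + u) ω) ∈ B}) := by
        conv_lhs => rw [hU]
        refine measure_iUnion ?_ fun y => (M.meas h (measurableSet_singleton y)).inter (hs hB)
        intro i j hij
        refine Set.disjoint_left.2 fun ω h1 h2 => hij ?_
        exact h1.1.symm.trans h2.1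
    _ = _ := tsum_congr fun y => M.markov x y h B hB

end AbsorbedProcess

/-- Paths which, observed at the times `0, h, 2h, …`, stay in `D` before step `k` and lie in `K`
at step `k`. -/
def gridHit (D K : Set ℕ) (h : ℝ≥0) : ℕ → Set (ℝ≥0 → ℕ)
  | 0 => {w | w 0 ∈ K}
  | k + 1 => {w | w 0 ∈ D ∧ (fun u => w (h + u)) ∈ gridHit D K h k}

/-- Paths which, observed at the times `0, h, 2h, …`, do not reach `K` through `D` within the
first `m` steps. -/
def gridMiss (D K : Set ℕ) (h : ℝ≥0) : ℕ → Set (ℝ≥0 → ℕ)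
  | 0 => {w | w 0 ∉ K}
  | m + 1 => {w | w 0 ∉ K ∧ (w 0 ∈ D → (fun u => w (h + u)) ∈ gridMiss D K h m)}

section Grid

variable (D K : Set ℕ) (h : ℝ≥0)

lemma measurable_shift : Measurable fun (w : ℝ≥0 → ℕ) (u : ℝ≥0) => w (h + u) :=
  measurable_pi_lambda _ fun u => measurable_pi_apply (h + u)

lemma measurableSet_eval_zero (S : Set ℕ) : MeasurableSet {w : ℝ≥0 → ℕ | w 0 ∈ S} :=
  measurable_pi_apply (0 : ℝ≥0) (MeasurableSet.of_discrete (s := S))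

lemma measurableSet_gridHit (k : ℕ) : MeasurableSet (gridHit D K h k) := by
  induction k with
  | zero => exact measurableSet_eval_zero K
  | succ k ih => exact (measurableSet_eval_zero D).inter (measurable_shift h ih)

lemma measurableSet_gridMiss (m : ℕ) : MeasurableSet (gridMiss D K h m) := by
  induction m with
  | zero => exact (measurableSet_eval_zero K).compl
  | succ m ih =>
    exact (measurableSet_eval_zero K).compl.inter
      (MeasurableSet.imp (measurableSet_eval_zero D) (measurable_shift h ih))

variable {D K h}

lemma apply_mem_of_mem_gridHit {k : ℕ} {w : ℝ≥0 → ℕ} (hw : w ∈ gridHit D K h k) :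
    w (k * h) ∈ K := by
  induction k generalizing w with
  | zero => simpa [gridHit] using hw
  | succ k ih =>
    have := ih hw.2
    have e : h + k * h = ((k + 1 : ℕ) : ℝ≥0) * h := by push_cast; ring
    rwa [e] at this

lemma exists_mem_gridHit_of_notMem_gridMiss {m : ℕ} {w : ℝ≥0 → ℕ} (hw : w ∉ gridMiss D K h m) :
    ∃ k < m + 1, w ∈ gridHit D K h k := by
  induction m generalizing w with
  | zero => exact ⟨0, by simp, not_not.1 hw⟩
  | succ m ih =>
    by_cases h0 : w 0 ∈ K
    · exact ⟨0, by omega, h0⟩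
    · have hw' : ¬(w 0 ∈ D → (fun u => w (h + u)) ∈ gridMiss D K h m) := fun hc => hw ⟨h0, hc⟩
      obtain ⟨hD, hs⟩ := Classical.not_imp.1 hw'
      obtain ⟨k, hk, hk'⟩ := ih hs
      exact ⟨k + 1, by omega, hD, hk'⟩

end Grid

namespace AbsorbedProcess

lemma sum_pow_mul_pathProb_gridHit_le (M : AbsorbedProcess Ω) {D K : Set ℕ} (hDK : Disjoint D K)
    (h : ℝ≥0) (a : ℝ≥0∞) (g : ℕ → ℝ≥0∞) (hK : ∀ x ∈ K, 1 ≤ g x)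
    (hD : ∀ x ∈ D, a * ∑' y, M.P x {ω | M.X h ω = y} * g y ≤ g x) (m x : ℕ) :
    ∑ k ∈ Finset.range m, a ^ k * M.pathProb x (gridHit D K h k) ≤ g x := by
  induction m generalizing x with
  | zero => simp
  | succ m ih =>
    rw [Finset.sum_range_succ']
    by_cases hxD : x ∈ D
    · have h0 : M.pathProb x (gridHit D K h 0) = 0 := by
        rw [M.pathProb_congr x (B := ∅)]
        · simp [pathProb]
        · rintro w rfl
          simpa [gridHit] using Set.disjoint_left.1 hDK hxD
      have hs (k : ℕ) : M.pathProb x (gridHit D K h (k + 1))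
          = ∑' y, M.P x {ω | M.X h ω = y} * M.pathProb y (gridHit D K h k) := by
        rw [← M.pathProb_shift x h (measurableSet_gridHit D K h k)]
        refine M.pathProb_congr x ?_
        rintro w rfl
        exact ⟨fun hw => hw.2, fun hw => ⟨hxD, hw⟩⟩
      rw [h0, mul_zero, add_zero]
      calc ∑ k ∈ Finset.range m, a ^ (k + 1) * M.pathProb x (gridHit D K h (k + 1))
          = a * ∑' y, M.P x {ω | M.X h ω = y}
              * ∑ k ∈ Finset.range m, a ^ k * M.pathProb y (gridHit D K h k) := by
            simp_rw [hs, Finset.mul_sum]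
            rw [Summable.tsum_finsetSum fun _ _ => ENNReal.summable, Finset.mul_sum]
            refine Finset.sum_congr rfl fun k _ => ?_
            rw [← ENNReal.tsum_mul_left, ← ENNReal.tsum_mul_left]
            refine tsum_congr fun y => ?_
            ring
        _ ≤ a * ∑' y, M.P x {ω | M.X h ω = y} * g y := by
            gcongr with y
            exact ih y
        _ ≤ g x := hD x hxD
    · have hs (k : ℕ) : M.pathProb x (gridHit D K h (k + 1)) = 0 := by
        rw [M.pathProb_congr x (B := ∅)]
        · simp [pathProb]
        · rintro w rfl
          simp [gridHit, hxD]
      simp only [hs, mul_zero, Finset.sum_const_zero, zero_add, pow_zero, one_mul]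
      by_cases hxK : x ∈ K
      · exact (M.pathProb_le_one _ _).trans (hK x hxK)
      · rw [M.pathProb_congr x (B := ∅)]
        · simp [pathProb]
        · rintro w rfl
          simpa [gridHit] using hxK

lemma pathProb_gridMiss_le (M : AbsorbedProcess Ω) {D K : Set ℕ} (h : ℝ≥0) (q : ℝ≥0∞)
    (g V : ℕ → ℝ≥0∞) (hg : ∀ x, 1 ≤ g x) (hV : ∀ x, x ∉ K → x ∉ D → 1 ≤ V x)
    (hDg : ∀ x ∈ D, ∑' y, M.P x {ω | M.X h ω = y} * g y ≤ q * g x)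
    (hDV : ∀ x ∈ D, ∑' y, M.P x {ω | M.X h ω = y} * V y ≤ V x) (m x : ℕ) :
    M.pathProb x (gridMiss D K h m) ≤ V x + q ^ m * g x := by
  induction m generalizing x with
  | zero =>
    simp only [pow_zero, one_mul]
    exact (M.pathProb_le_one _ _).trans ((hg x).trans le_add_self)
  | succ m ih =>
    by_cases hxK : x ∈ K
    · rw [M.pathProb_congr x (B := ∅)]
      · simp [pathProb]
      · rintro w rfl
        simp [gridMiss, hxK]
    by_cases hxD : x ∈ D
    · have hs : M.pathProb x (gridMiss D K h (m + 1))
          = ∑' y, M.P x {ω | M.X h ω = y} * M.pathProb y (gridMiss D K h m) := by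
        rw [← M.pathProb_shift x h (measurableSet_gridMiss D K h m)]
        refine M.pathProb_congr x ?_
        rintro w rfl
        exact ⟨fun hw => hw.2 hxD, fun hw => ⟨hxK, fun _ => hw⟩⟩
      calc M.pathProb x (gridMiss D K h (m + 1))
          ≤ ∑' y, M.P x {ω | M.X h ω = y} * (V y + q ^ m * g y) := by
            rw [hs]
            gcongr with y
            exact ih y
        _ = ∑' y, M.P x {ω | M.X h ω = y} * V y
              + q ^ m * ∑' y, M.P x {ω | M.X h ω = y} * g y := by
            rw [← ENNReal.tsum_mul_left, ← ENNReal.tsum_add]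
            refine tsum_congr fun y => ?_
            ring
        _ ≤ V x + q ^ m * (q * g x) := by
            gcongr
            · exact hDV x hxD
            · exact hDg x hxD
        _ = V x + q ^ (m + 1) * g x := by ring
    · exact (M.pathProb_le_one _ _).trans ((hV x hxK hxD).trans le_self_add)

lemma transFn_zero (M : AbsorbedProcess Ω) (x y : ℕ) :
    transFn M 0 x y = if y = x then 1 else 0 := by
  unfold transFn
  rw [Real.toNNReal_zero]
  split_ifs with hxy
  · rw [hxy, M.init x, ENNReal.toReal_one]
  · have : M.P x {ω | M.X 0 ω = y} = 0 := by
      refine measure_mono_null ?_ (M.ae_init x)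
      intro ω hω hx
      exact hxy (hω.symm.trans hx)
    rw [this, ENNReal.toReal_zero]

lemma hasSum_transFn (M : AbsorbedProcess Ω) (t : ℝ) (x : ℕ) :
    HasSum (fun y => transFn M t x y) 1 := by
  have := M.prob x
  have h1 : ∑' y, M.P x {ω | M.X t.toNNReal ω = y} = 1 := by
    rw [← measure_iUnion]
    · rw [← measure_univ (μ := M.P x)]
      congr 1
      ext ω; simp
    · intro i j hij
      exact Set.disjoint_left.2 fun ω h1 h2 => hij (h1.symm.trans h2)
    · exact fun y => M.meas _ (measurableSet_singleton y)
  have := ENNReal.hasSum_toReal (f := fun y => M.P x {ω | M.X t.toNNReal ω = y}) (by simp [h1])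
  rw [← ENNReal.tsum_toReal_eq fun y => measure_ne_top _ _, h1, ENNReal.toReal_one] at this
  exact this

/-- A bounded function is integrated by the transition function at most as if all the mass outside
a finite set `s` sat at its upper bound. -/
lemma tsum_mul_ofReal_le (M : AbsorbedProcess Ω) (h : ℝ≥0) (x : ℕ) (s : Finset ℕ) {g : ℕ → ℝ}
    {B : ℝ} (hg0 : ∀ y, 0 ≤ g y) (hgB : ∀ y, g y ≤ B) :
    ∑' y, M.P x {ω | M.X h ω = y} * ENNReal.ofReal (g y)
      ≤ ENNReal.ofReal (B - ∑ y ∈ s, transFn M h x y * (B - g y)) := by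
  have := M.prob x
  have hp (y : ℕ) : 0 ≤ transFn M h x y := ENNReal.toReal_nonneg
  have hsum := M.hasSum_transFn h x
  have hS : Summable fun y => transFn M h x y * g y :=
    Summable.of_nonneg_of_le (fun y => mul_nonneg (hp y) (hg0 y))
      (fun y => mul_le_mul_of_nonneg_left (hgB y) (hp y)) (hsum.summable.mul_right B)
  have hd : HasSum (fun y => transFn M h x y * (B - g y))
      (B - ∑' y, transFn M h x y * g y) := by
    simpa [mul_sub] using (hsum.mul_right B).sub hS.hasSum
  have hle := sum_le_hasSum s (fun y _ => mul_nonneg (hp y) (sub_nonneg.2 (hgB y))) hd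
  calc ∑' y, M.P x {ω | M.X h ω = y} * ENNReal.ofReal (g y)
      = ∑' y, ENNReal.ofReal (transFn M h x y * g y) := by
        refine tsum_congr fun y => ?_
        rw [ENNReal.ofReal_mul (hp y), transFn, Real.toNNReal_coe,
          ENNReal.ofReal_toReal (measure_ne_top _ _)]
    _ = ENNReal.ofReal (∑' y, transFn M h x y * g y) :=
        (ENNReal.ofReal_tsum_of_nonneg (fun y => mul_nonneg (hp y) (hg0 y)) hS).symm
    _ ≤ _ := ENNReal.ofReal_le_ofReal (by linarith)

end AbsorbedProcess

lemma HasDerivWithinAt.eventually_lt_of_neg {f : ℝ → ℝ} {f' a : ℝ}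
    (hf : HasDerivWithinAt f f' (Ici a) a) (hf' : f' < 0) :
    ∀ᶠ t in nhdsWithin a (Ioi a), f t < f a := by
  have h1 := (hasDerivWithinAt_iff_tendsto_slope' (by simp)).1 (hf.mono Ioi_subset_Ici_self)
  filter_upwards [h1.eventually (gt_mem_nhds hf'), self_mem_nhdsWithin] with t ht hta
  have hta' : 0 < t - a := sub_pos.2 hta
  rw [slope_def_field, div_lt_iff₀ hta'] at ht
  linarith

namespace AbsorbedProcess

/-- If `l g + Q g < 0` at a state `x ≥ 1` of the logistic chain, with `g` bounded, then
`e^{l h} P_h g ≤ g` at `x` for all small `h > 0`. -/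
lemma eventually_exp_mul_tsum_le (M : AbsorbedProcess Ω) {b d c : ℝ}
    (hQ : IsRateMatrixOf M (Qlog b d c)) {g : ℕ → ℝ} {B : ℝ} (hg0 : ∀ y, 0 ≤ g y)
    (hgB : ∀ y, g y ≤ B) (l : ℝ) (x : ℕ)
    (hneg : l * g (x + 1) + b * (x + 1 : ℕ) * (g (x + 2) - g (x + 1))
      + (d * (x + 1 : ℕ) + c * (x + 1 : ℕ) * x) * (g x - g (x + 1)) < 0) :
    ∀ᶠ t in nhdsWithin (0 : ℝ) (Ioi 0),
      ENNReal.ofReal (Real.exp (l * t))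
        * ∑' y, M.P (x + 1) {ω | M.X t.toNNReal ω = y} * ENNReal.ofReal (g y)
        ≤ ENNReal.ofReal (g (x + 1)) := by
  have hder := hQ.2.2.2.2 (x + 1)
  have h0 := (hder x).mul_const (B - g x)
  have h1 := (hder (x + 1)).mul_const (B - g (x + 1))
  have h2 := (hder (x + 2)).mul_const (B - g (x + 2))
  have hexp : HasDerivWithinAt (fun t : ℝ => Real.exp (l * t)) (Real.exp (l * 0) * (l * 1))
      (Ici 0) 0 := (((hasDerivAt_id (0 : ℝ)).const_mul l).exp).hasDerivWithinAt
  have hφ := hexp.mul (((h0.add h1).add h2).const_sub B)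
  have hp0 : transFn M 0 (x + 1) x = 0 := by simp [transFn_zero]
  have hp1 : transFn M 0 (x + 1) (x + 1) = 1 := by simp [transFn_zero]
  have hp2 : transFn M 0 (x + 1) (x + 2) = 0 := by simp [transFn_zero]
  have hq0 : Qlog b d c (x + 1) x = d * (x + 1 : ℕ) + c * (x + 1 : ℕ) * x := by
    simp [Qlog, show x ≠ x + 1 + 1 by omega]
  have hq1 : Qlog b d c (x + 1) (x + 1)
      = -(b * (x + 1 : ℕ) + d * (x + 1 : ℕ) + c * (x + 1 : ℕ) * x) := by
    simp [Qlog]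
  have hq2 : Qlog b d c (x + 1) (x + 2) = b * (x + 1 : ℕ) := by simp [Qlog]
  have hφ0 := hφ.eventually_lt_of_neg (by
    simp only [Pi.add_apply, hp0, hp1, hp2, hq0, hq1, hq2, mul_zero, Real.exp_zero]
    linarith)
  filter_upwards [hφ0, self_mem_nhdsWithin] with t ht htpos
  have htpos' : 0 ≤ t := le_of_lt htpos
  have key := M.tsum_mul_ofReal_le t.toNNReal (x + 1) {x, x + 1, x + 2} hg0 hgB
  rw [Finset.sum_insert (by simp), Finset.sum_insert (by simp), Finset.sum_singleton,
    Real.coe_toNNReal t htpos'] at key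
  refine (mul_le_mul_right key _).trans ?_
  rw [← ENNReal.ofReal_mul (Real.exp_nonneg _)]
  refine ENNReal.ofReal_le_ofReal ?_
  simp only [Pi.mul_apply, Pi.add_apply, hp0, hp1, hp2, mul_zero, Real.exp_zero] at ht
  rw [← add_assoc]
  linarith

end AbsorbedProcess

/-- The bounded Lyapunov function `2 - z / max y z` of the logistic chain. -/
def returnLyapunov (z y : ℕ) : ℝ := 2 - z / (max y z : ℕ)

lemma one_le_returnLyapunov (z y : ℕ) : 1 ≤ returnLyapunov z y := by
  have : (z : ℝ) / (max y z : ℕ) ≤ 1 :=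
    div_le_one_of_le₀ (by exact_mod_cast le_max_right y z) (Nat.cast_nonneg _)
  unfold returnLyapunov
  linarith

lemma returnLyapunov_le_two (z y : ℕ) : returnLyapunov z y ≤ 2 := by
  have : (0 : ℝ) ≤ (z : ℝ) / (max y z : ℕ) := by positivity
  unfold returnLyapunov
  linarith

lemma returnLyapunov_generator_neg {b d c : ℝ} (hb : 0 < b) (hd : 0 < d) {z : ℕ} (hz : 1 ≤ z)
    (hzc : 2 * (b + d) + b < c * z) {x : ℕ} (hx : z ≤ x) :
    (b + d) * returnLyapunov z (x + 1)
      + b * (x + 1 : ℕ) * (returnLyapunov z (x + 2) - returnLyapunov z (x + 1))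
      + (d * (x + 1 : ℕ) + c * (x + 1 : ℕ) * x)
        * (returnLyapunov z x - returnLyapunov z (x + 1)) < 0 := by
  have hxpos : (0 : ℝ) < x := by exact_mod_cast hz.trans hx
  have hzx : (z : ℝ) ≤ x := by exact_mod_cast hx
  have e0 : returnLyapunov z x = 2 - z / x := by simp [returnLyapunov, max_eq_left hx]
  have e1 : returnLyapunov z (x + 1) = 2 - z / (x + 1) := by
    simp [returnLyapunov, max_eq_left (show z ≤ x + 1 by omega)]
  have e2 : returnLyapunov z (x + 2) = 2 - z / (x + 2) := by
    simp [returnLyapunov, max_eq_left (show z ≤ x + 2 by omega)]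
  have hp0 : (0 : ℝ) ≤ z / x := by positivity
  have hp1 : (0 : ℝ) ≤ z / (x + 1) := by positivity
  have hp2 : (z : ℝ) / (x + 2) ≤ 1 := div_le_one_of_le₀ (by linarith) (by linarith)
  have hbirth : ((x : ℝ) + 1) * (z / (x + 1) - z / (x + 2)) = z / (x + 2) := by
    field_simp; ring
  have hdeath : ((x : ℝ) + 1) * (z / x - z / (x + 1)) = z / x := by
    field_simp; ring
  have hxz : (x : ℝ) * (z / x) = z := by field_simp
  rw [e0, e1, e2]
  push_cast
  have : (b + d) * (2 - z / (x + 1)) + b * (x + 1) * (2 - z / (x + 2) - (2 - z / (x + 1)))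
      + (d * (x + 1) + c * (x + 1) * x) * (2 - z / x - (2 - z / ((x : ℝ) + 1)))
      = (b + d) * (2 - z / (x + 1)) + b * (z / (x + 2)) - d * (z / x) - c * z := by
    linear_combination b * hbirth - (d + c * x) * hdeath - c * hxz
  rw [this]
  nlinarith [mul_nonneg (add_pos hb hd).le hp1, mul_nonneg hd.le hp0,
    mul_le_mul_of_nonneg_left hp2 hb.le]

/-- Bounds the probability of leaving `{1, …, N}` at `0` or above `N` without meeting the
bottom part of that interval. -/
def escapeLyapunov (N y : ℕ) : ℝ := if y = 0 ∨ N < y then 1 else y / (N + 1)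

lemma escapeLyapunov_nonneg (N y : ℕ) : 0 ≤ escapeLyapunov N y := by
  unfold escapeLyapunov
  split_ifs <;> positivity

lemma escapeLyapunov_le_one (N y : ℕ) : escapeLyapunov N y ≤ 1 := by
  unfold escapeLyapunov
  split_ifs with h
  · exact le_rfl
  · push Not at h
    have : (y : ℝ) ≤ N := by exact_mod_cast h.2
    exact div_le_one_of_le₀ (by linarith) (by positivity)

lemma escapeLyapunov_of_le {N y : ℕ} (hy : y ≠ 0) (hyN : y ≤ N + 1) :
    escapeLyapunov N y = y / (N + 1) := by
  unfold escapeLyapunov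
  split_ifs with h
  · obtain rfl : y = N + 1 := by omega
    have : ((N : ℝ) + 1) ≠ 0 := by positivity
    push_cast
    rw [div_self this]
  · rfl

lemma escapeLyapunov_generator_neg {b d c : ℝ} (hd : 0 < d) (hc : 0 < c) {z : ℕ}
    (hz : 1 ≤ z) (hzc : b < c * z) {x N : ℕ} (hx : z ≤ x) (hxN : x < N) :
    0 * escapeLyapunov N (x + 1)
      + b * (x + 1 : ℕ) * (escapeLyapunov N (x + 2) - escapeLyapunov N (x + 1))
      + (d * (x + 1 : ℕ) + c * (x + 1 : ℕ) * x)
        * (escapeLyapunov N x - escapeLyapunov N (x + 1)) < 0 := by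
  rw [escapeLyapunov_of_le (y := x) (by omega) (by omega),
    escapeLyapunov_of_le (y := x + 1) (by omega) (by omega),
    escapeLyapunov_of_le (y := x + 2) (by omega) (by omega)]
  have hzx : (z : ℝ) ≤ x := by exact_mod_cast hx
  have hneg : b - (d + c * x) < 0 := by nlinarith [mul_le_mul_of_nonneg_left hzx hc.le]
  push_cast
  have : 0 * (((x : ℝ) + 1) / (N + 1)) + b * (x + 1) * ((x + 2) / (N + 1) - (x + 1) / (N + 1))
      + (d * (x + 1) + c * (x + 1) * x) * (x / (N + 1) - (x + 1) / (N + 1))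
      = (b - (d + c * x)) * ((x + 1) / (N + 1)) := by
    field_simp; ring
  rw [this]
  exact mul_neg_of_neg_of_pos hneg (by positivity)

lemma expE_hitT_le_s17 (M : AbsorbedProcess Ω) {K : Set ℕ} {l : ℝ} (hl : 0 ≤ l) {ω : Ω} {t : ℝ≥0}
    (ht : M.X t ω ∈ K) : expE l (hitT M K ω) ≤ ENNReal.ofReal (Real.exp (l * t)) := by
  have hle : hitT M K ω ≤ t := iInf_le (fun s : {s : ℝ≥0 // M.X s ω ∈ K} => (s.1 : ℝ≥0∞)) ⟨t, ht⟩
  have hne : hitT M K ω ≠ ∞ := ne_top_of_le_ne_top coe_ne_top hle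
  have hre : (hitT M K ω).toReal ≤ t := by
    simpa using ENNReal.toReal_mono coe_ne_top hle
  rw [expE, if_neg hne]
  gcongr

lemma exists_measurable_approx_expE_hitT {b d c : ℝ} (hb : 0 < b) (hd : 0 < d) (hc : 0 < c)
    (M : AbsorbedProcess Ω) (hQ : IsRateMatrixOf M (Qlog b d c)) {z : ℕ} (hz : 1 ≤ z)
    (hzc : 2 * (b + d) + b < c * z) {x : ℕ} (hx : x ≠ 0) {ε : ℝ≥0∞} (hε : ε ≠ 0) :
    ∃ F : Ω → ℝ≥0∞, Measurable F ∧ ∫⁻ ω, F ω ∂M.P x ≤ ENNReal.ofReal 2 ∧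
      M.P x {ω | ¬ expE (b + d) (hitT M {n : ℕ | 1 ≤ n ∧ n ≤ z} ω) ≤ F ω} ≤ ε := by
  set K : Set ℕ := {n : ℕ | 1 ≤ n ∧ n ≤ z} with hKdef
  have hl : 0 < b + d := add_pos hb hd
  have hε2 : 0 < ε / 2 := ENNReal.half_pos hε
  obtain ⟨N, hxN, hVx⟩ : ∃ N, x ≤ N ∧ ENNReal.ofReal (escapeLyapunov N x) ≤ ε / 2 := by
    have h1 : Tendsto (fun N : ℕ => ENNReal.ofReal ((x : ℝ) / ((N + 1 : ℕ) : ℝ))) atTop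
        (nhds 0) := by
      rw [← ENNReal.ofReal_zero]
      exact (ENNReal.continuous_ofReal.tendsto 0).comp
        ((tendsto_const_div_atTop_nhds_zero_nat (x : ℝ)).comp (tendsto_add_atTop_nat 1))
    obtain ⟨N, hN, hNx⟩ := ((h1.eventually_le_const hε2).and (eventually_ge_atTop x)).exists
    refine ⟨N, hNx, ?_⟩
    rw [escapeLyapunov_of_le hx (by omega)]
    simpa using hN
  set D : Set ℕ := {n : ℕ | z < n ∧ n ≤ N} with hDdef
  have hDK : Disjoint D K :=
    Set.disjoint_left.2 fun n hn hn' => absurd hn.1 (not_lt.2 hn'.2)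
  obtain ⟨t, ⟨hG, hV⟩, htpos⟩ :=
    ((((Filter.eventually_all_finset (Finset.Ico z N)).2 fun y hy =>
      M.eventually_exp_mul_tsum_le hQ
        (fun n => zero_le_one.trans (one_le_returnLyapunov z n)) (returnLyapunov_le_two z) _ y
        (returnLyapunov_generator_neg hb hd hz hzc (Finset.mem_Ico.1 hy).1)).and
    ((Filter.eventually_all_finset (Finset.Ico z N)).2 fun y hy =>
      M.eventually_exp_mul_tsum_le hQ (escapeLyapunov_nonneg N) (escapeLyapunov_le_one N) 0 y
        (escapeLyapunov_generator_neg hd hc hz (by linarith) (Finset.mem_Ico.1 hy).1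
          (Finset.mem_Ico.1 hy).2))).and self_mem_nhdsWithin).exists
  replace htpos : 0 < t := htpos
  set h : ℝ≥0 := t.toNNReal with hh
  set a : ℝ≥0∞ := ENNReal.ofReal (Real.exp ((b + d) * t)) with ha
  set q : ℝ≥0∞ := ENNReal.ofReal (Real.exp (-((b + d) * t))) with hq
  set g : ℕ → ℝ≥0∞ := fun y => ENNReal.ofReal (returnLyapunov z y)
  set V : ℕ → ℝ≥0∞ := fun y => ENNReal.ofReal (escapeLyapunov N y) with hVdef
  have hg1 (y : ℕ) : 1 ≤ g y := ENNReal.one_le_ofReal.2 (one_le_returnLyapunov z y)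
  have hg2 (y : ℕ) : g y ≤ ENNReal.ofReal 2 :=
    ENNReal.ofReal_le_ofReal (returnLyapunov_le_two z y)
  have hDg : ∀ y ∈ D, a * ∑' n, M.P y {ω | M.X h ω = n} * g n ≤ g y := by
    rintro (_ | y) ⟨hy1, hy2⟩
    · omega
    · exact hG y (Finset.mem_Ico.2 ⟨by omega, by omega⟩)
  have hDV : ∀ y ∈ D, ∑' n, M.P y {ω | M.X h ω = n} * V n ≤ V y := by
    rintro (_ | y) ⟨hy1, hy2⟩
    · omega
    · simpa using hV y (Finset.mem_Ico.2 ⟨by omega, by omega⟩)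
  have hqa : q * a = 1 := by
    rw [hq, ha, ← ENNReal.ofReal_mul (Real.exp_nonneg _), ← Real.exp_add]
    simp
  have hq1 : q < 1 := by
    rw [hq, ENNReal.ofReal_lt_one, Real.exp_lt_one_iff]
    nlinarith
  have hDg' : ∀ y ∈ D, ∑' n, M.P y {ω | M.X h ω = n} * g n ≤ q * g y := by
    intro y hy
    calc ∑' n, M.P y {ω | M.X h ω = n} * g n
        = q * (a * ∑' n, M.P y {ω | M.X h ω = n} * g n) := by rw [← mul_assoc, hqa, one_mul]
      _ ≤ q * g y := by gcongr; exact hDg y hy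
  have hV1 : ∀ y, y ∉ K → y ∉ D → 1 ≤ V y := by
    intro y hyK hyD
    have hy : y = 0 ∨ N < y := by
      simp only [hKdef, hDdef, Set.mem_ofPred_eq] at hyK hyD
      omega
    simp [hVdef, escapeLyapunov, hy]
  obtain ⟨m, hm⟩ : ∃ m : ℕ, q ^ m * g x ≤ ε / 2 := by
    have h1 := ENNReal.Tendsto.mul_const (b := g x)
      (ENNReal.tendsto_pow_atTop_nhds_zero_of_lt_one hq1) (Or.inr ENNReal.ofReal_ne_top)
    rw [zero_mul] at h1
    exact (h1.eventually_le_const hε2).exists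
  have hmeas (k : ℕ) : MeasurableSet {ω | (fun u => M.X u ω) ∈ gridHit D K h k} :=
    M.measurable_path (measurableSet_gridHit D K h k)
  refine ⟨fun ω => ∑ k ∈ Finset.range (m + 1),
    a ^ k * {ω | (fun u => M.X u ω) ∈ gridHit D K h k}.indicator 1 ω, ?_, ?_, ?_⟩
  · exact Finset.measurable_sum _ fun k _ => (measurable_one.indicator (hmeas k)).const_mul _
  · rw [lintegral_finsetSum _ fun k _ => (measurable_one.indicator (hmeas k)).const_mul _]
    simp_rw [lintegral_const_mul _ (measurable_one.indicator (hmeas _)),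
      lintegral_indicator_one (hmeas _)]
    exact (M.sum_pow_mul_pathProb_gridHit_le hDK h a g (fun y _ => hg1 y) hDg (m + 1) x).trans
      (hg2 x)
  · calc _ ≤ M.pathProb x (gridMiss D K h m) := by
          refine measure_mono fun ω hω => ?_
          by_contra hmiss
          obtain ⟨k, hk, hkw⟩ := exists_mem_gridHit_of_notMem_gridMiss hmiss
          refine hω ?_
          calc expE (b + d) (hitT M K ω)
              ≤ ENNReal.ofReal (Real.exp ((b + d) * (k * h : ℝ≥0))) :=
                expE_hitT_le_s17 M hl.le (apply_mem_of_mem_gridHit hkw)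
            _ = a ^ k * {ω | (fun u => M.X u ω) ∈ gridHit D K h k}.indicator 1 ω := by
                rw [Set.indicator_of_mem
                    (s := {ω | (fun u => M.X u ω) ∈ gridHit D K h k}) hkw, Pi.one_apply, mul_one, ha,
                  ← ENNReal.ofReal_pow (Real.exp_nonneg _), ← Real.exp_nat_mul]
                congr 2
                push_cast
                rw [hh, Real.coe_toNNReal t htpos.le]
                ring
            _ ≤ _ := Finset.single_le_sum
                (f := fun k => a ^ k * {ω | (fun u => M.X u ω) ∈ gridHit D K h k}.indicator 1 ω)
                (fun _ _ => zero_le) (Finset.mem_range.2 hk)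
      _ ≤ V x + q ^ m * g x := M.pathProb_gridMiss_le h q g V hg1 hV1 hDg' hDV m x
      _ ≤ ε / 2 + ε / 2 := add_le_add hVx hm
      _ = ε := ENNReal.add_halves ε

lemma lintegral_le_of_forall_measurable_approx {μ : Measure Ω} {f : Ω → ℝ≥0∞} {C : ℝ≥0∞}
    (hf : ∀ ε : ℝ≥0∞, ε ≠ 0 → ∃ F : Ω → ℝ≥0∞, Measurable F ∧ ∫⁻ ω, F ω ∂μ ≤ C ∧
      μ {ω | ¬ f ω ≤ F ω} ≤ ε) :
    ∫⁻ ω, f ω ∂μ ≤ C := by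
  obtain ⟨ε, hεpos, hεsum⟩ := ENNReal.exists_pos_sum_of_countable' one_ne_zero ℕ
  choose F hFm hFC hFε using fun n => hf (ε n) (hεpos n).ne'
  have hbad : ∑' n, μ {ω | ¬ f ω ≤ F n ω} ≠ ∞ :=
    ((ENNReal.tsum_le_tsum hFε).trans_lt (hεsum.trans one_lt_top)).ne
  have hle : f ≤ᵐ[μ] fun ω => liminf (fun n => F n ω) atTop := by
    filter_upwards [ae_eventually_notMem hbad] with ω hω
    exact le_liminf_of_le (by isBoundedDefault) (hω.mono fun n hn => not_not.1 hn)
  calc ∫⁻ ω, f ω ∂μ ≤ ∫⁻ ω, liminf (fun n => F n ω) atTop ∂μ := lintegral_mono_ae hle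
    _ ≤ liminf (fun n => ∫⁻ ω, F n ω ∂μ) atTop := lintegral_liminf_le hFm
    _ ≤ C := liminf_le_of_le (by isBoundedDefault) fun c hc => by
        obtain ⟨n, hn⟩ := hc.exists
        exact hn.trans (hFC n)

/-- for the logistic birth and death process with parameters
`b, d, c > 0` and `λ₀ = b + d`, there exists `z₀ ∈ ℕ*` such that, with
`K = {1, …, z₀}`, `sup_{x∈ℕ*} 𝔼_x(e^{λ₀ T_K}) < ∞`. -/
theorem logistic_exponential_return (b d c : ℝ) (hb : 0 < b) (hd : 0 < d) (hc : 0 < c)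
    (M : AbsorbedProcess Ω) (hQ : IsRateMatrixOf M (Qlog b d c)) :
    ∃ z0 : ℕ, 1 ≤ z0 ∧ ∃ Cb : ℝ, ∀ x : ℕ, x ≠ 0 →
      ∫⁻ ω, expE (b + d) (hitT M {n : ℕ | 1 ≤ n ∧ n ≤ z0} ω) ∂ M.P x
        ≤ ENNReal.ofReal Cb := by
  obtain ⟨z, hz⟩ := exists_nat_gt ((2 * (b + d) + b) / c)
  have hzc : 2 * (b + d) + b < c * z := by
    rw [div_lt_iff₀ hc] at hz
    linarith
  have hz1 : 1 ≤ z := by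
    rw [Nat.one_le_iff_ne_zero]
    rintro rfl
    rw [Nat.cast_zero, mul_zero] at hzc
    linarith
  exact ⟨z, hz1, 2, fun x hx => lintegral_le_of_forall_measurable_approx fun ε hε =>
    exists_measurable_approx_expE_hitT hb hd hc M hQ hz1 hzc hx hε⟩

end
end
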